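/- Let J_{i,j} denote the set of tuples Θ ∈ {1,...,n}^{i−j+1} with d_{i,j}(Θ) ≠ 0, and let S_n be the set of all finite products ∏_{1≤j≤i≤n} ∏_{Θ∈J_{i,j}} d_{i,j}(Θ)^{α_{i,j}(Θ)} whose exponents α_{i,j}(Θ) ∈ ℕ satisfy, for each j ∈ {1,...,n}, the constraint ∑_{i=j}^{n} ∑_{Θ∈J_{i,j}} α_{i,j}(Θ) ≤ k_{n−j+1}. Let (S_n)_0 ⊂ S_n be the subset of such products with α_{n,j}(Θ) = 0 for all j and Θ. Then the smallest ℂ-subspace of R containing (S_n)_0 and invariant under all the operators ρ_{i,j} (1 ≤ i,j ≤ n+1) equals the ℂ-linear span of S_n. -/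

import Mathlib

open MvPolynomial Finset

noncomputable section

/-- The polynomial ring `R = ℂ[x_{i,j}]` (we use variables indexed by pairs of naturals;
only those with `1 ≤ j ≤ i ≤ n` are relevant). -/
abbrev Rpoly : Type := MvPolynomial (ℕ × ℕ) ℂ

/-- The extended variable `x_{i,j}`, with the conventions `x_{i,i+1} = -1` and
`x_{i,j} = 0` for `j > i + 1`. -/
def Xv (i j : ℕ) : Rpoly :=
  if j ≤ i then MvPolynomial.X (i, j) else if j = i + 1 then -1 else 0

/-- `d_{i,j}(Θ)`: the determinant of the `(i-j+1) × (i-j+1)` matrix whose `(a,b)` entry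
is `x_{j+a-1, θ_b}` (rows indexed by `j, j+1, ..., i`). -/
def dPoly (i j : ℕ) (Θ : Fin (i - j + 1) → ℕ) : Rpoly :=
  Matrix.det (Matrix.of fun a b : Fin (i - j + 1) => Xv (j + a.1) (Θ b))

/-- `D_{i,j}(s) = d_{i,j}(s, j+1, j+2, ..., i)`. -/
def DPoly (i j s : ℕ) : Rpoly :=
  dPoly i j (fun b => if b.1 = 0 then s else j + b.1)

/-- The partial derivative `∂_{x_{p}}` as a `ℂ`-linear operator on `R`. -/
def pd (p : ℕ × ℕ) : Module.End ℂ Rpoly := (MvPolynomial.pderiv p).toLinearMap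

/-- Multiplication by a fixed polynomial, as a `ℂ`-linear operator on `R`. -/
def mulOp (a : Rpoly) : Module.End ℂ Rpoly := LinearMap.mulLeft ℂ a

/-- The operators `ρ_{i,j}` of the full projective oscillator representation of
`gl(n+1)` on `R`, for a constant `c ∈ ℂ` and weights `k_1, ..., k_n ∈ ℕ`. -/
def ρ (n : ℕ) (c : ℂ) (k : ℕ → ℕ) (i j : ℕ) : Module.End ℂ Rpoly :=
  if i = j then
    (c - ∑ r ∈ Finset.Icc i n, (k (n - r + 1) : ℂ)) • (1 : Module.End ℂ Rpoly)
      + ∑ r ∈ Finset.Icc i n, mulOp (Xv r i) ∘ₗ pd (r, i)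
      - ∑ s ∈ Finset.Icc 1 (i - 1), mulOp (Xv (i - 1) s) ∘ₗ pd (i - 1, s)
  else if j < i then
    - pd (i - 1, j) + ∑ r ∈ Finset.Icc i n, mulOp (Xv r i) ∘ₗ pd (r, j)
  else
    ∑ r ∈ Finset.Icc j n, mulOp (Xv r i) ∘ₗ pd (r, j)
      + ∑ s ∈ Finset.Icc (i - 1) (j - 1), ∑ t ∈ Finset.Icc 1 s,
          mulOp (DPoly (j - 1) s t * Xv s i) ∘ₗ pd (s, t)
      - mulOp (∑ s ∈ Finset.Icc i (j - 1), (k (n + 1 - s) : ℂ) • DPoly (j - 1) s i)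

/-- The finite set of tuples `Θ ∈ {1,...,n}^{i-j+1}`. -/
def tuples (n i j : ℕ) : Finset (Fin (i - j + 1) → ℕ) :=
  Fintype.piFinset fun _ => Finset.Icc 1 n

/-- The set `S_n(λ)` of products `∏_{1≤j≤i≤n} ∏_{Θ ∈ J_{i,j}} d_{i,j}(Θ)^{α_{i,j}(Θ)}`
with `∑_{i=j}^{n} ∑_{Θ ∈ J_{i,j}} α_{i,j}(Θ) ≤ k_{n-j+1}` for each `j ∈ {1,...,n}`.
(The exponents are required to vanish on tuples `Θ` with `d_{i,j}(Θ) = 0`, so that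
only `Θ ∈ J_{i,j}` contribute.) -/
def Sset (n : ℕ) (k : ℕ → ℕ) : Set Rpoly :=
  {f | ∃ α : (i j : ℕ) → (Fin (i - j + 1) → ℕ) → ℕ,
    (∀ i j Θ, dPoly i j Θ = 0 → α i j Θ = 0) ∧
    (∀ j ∈ Finset.Icc 1 n,
      ∑ i ∈ Finset.Icc j n, ∑ Θ ∈ tuples n i j, α i j Θ ≤ k (n - j + 1)) ∧
    f = ∏ i ∈ Finset.Icc 1 n, ∏ j ∈ Finset.Icc 1 i, ∏ Θ ∈ tuples n i j,
          dPoly i j Θ ^ α i j Θ}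

/-- The subset `(S_n(λ))₀` of such products with `α_{n,j}(Θ) = 0` for all `j, Θ`. -/
def Sset0 (n : ℕ) (k : ℕ → ℕ) : Set Rpoly :=
  {f | ∃ α : (i j : ℕ) → (Fin (i - j + 1) → ℕ) → ℕ,
    (∀ i j Θ, dPoly i j Θ = 0 → α i j Θ = 0) ∧
    (∀ j Θ, α n j Θ = 0) ∧
    (∀ j ∈ Finset.Icc 1 n,
      ∑ i ∈ Finset.Icc j n, ∑ Θ ∈ tuples n i j, α i j Θ ≤ k (n - j + 1)) ∧
    f = ∏ i ∈ Finset.Icc 1 n, ∏ j ∈ Finset.Icc 1 i, ∏ Θ ∈ tuples n i j,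
          dPoly i j Θ ^ α i j Θ}

/-! ### The Fischer inner product on polynomials -/

/-- The product of the factorials of the exponents of a monomial. -/
def monoFactorial (m : ℕ × ℕ →₀ ℕ) : ℕ := m.prod fun _ e => e.factorial

lemma monoFactorial_pos (m : ℕ × ℕ →₀ ℕ) : 0 < monoFactorial m :=
  Finset.prod_pos fun _ _ => Nat.factorial_pos _

lemma monoFactorial_add_single (m : ℕ × ℕ →₀ ℕ) (p : ℕ × ℕ) :
    monoFactorial (m + Finsupp.single p 1) = (m p + 1) * monoFactorial m := by
  classical
  have h : ∀ u : ℕ × ℕ →₀ ℕ, monoFactorial u =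
      (u p).factorial * (u.erase p).prod fun _ e => e.factorial := by
    intro u
    rw [monoFactorial, Finsupp.mul_prod_erase' u p (fun _ e => e.factorial)]
    simp
  rw [h, h m, Finsupp.erase_add]
  simp [Nat.factorial_succ, mul_assoc]

/-- The Fischer inner product, conjugate linear in the first argument. -/
def fischer (f g : Rpoly) : ℂ :=
  ∑ m ∈ f.support, (monoFactorial m : ℂ) * (starRingEnd ℂ (coeff m f) * coeff m g)

lemma fischer_eq_sum {f g : Rpoly} {S : Finset (ℕ × ℕ →₀ ℕ)} (h : f.support ⊆ S) :
    fischer f g = ∑ m ∈ S, (monoFactorial m : ℂ) * (starRingEnd ℂ (coeff m f) * coeff m g) := by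
  refine Finset.sum_subset h fun m _ hm => ?_
  rw [notMem_support_iff.mp hm]
  simp

lemma fischer_add_left (f f' g : Rpoly) :
    fischer (f + f') g = fischer f g + fischer f' g := by
  classical
  rw [fischer_eq_sum (S := f.support ∪ f'.support) support_add,
    fischer_eq_sum (f := f) Finset.subset_union_left,
    fischer_eq_sum (f := f') Finset.subset_union_right, ← Finset.sum_add_distrib]
  refine Finset.sum_congr rfl fun m _ => ?_
  rw [coeff_add, map_add]
  ring

lemma fischer_smul_left (c : ℂ) (f g : Rpoly) :
    fischer (c • f) g = starRingEnd ℂ c * fischer f g := by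
  rw [fischer_eq_sum (S := f.support) (support_smul), fischer, Finset.mul_sum]
  refine Finset.sum_congr rfl fun m _ => ?_
  rw [coeff_smul, smul_eq_mul, map_mul]
  ring

lemma fischer_conj_symm (f g : Rpoly) : starRingEnd ℂ (fischer g f) = fischer f g := by
  classical
  rw [fischer_eq_sum (f := g) (S := f.support ∪ g.support) Finset.subset_union_right,
    fischer_eq_sum (f := f) (S := f.support ∪ g.support) Finset.subset_union_left, map_sum]
  refine Finset.sum_congr rfl fun m _ => ?_
  simp only [map_mul, map_natCast, Complex.conj_conj]
  ring

lemma fischer_self (f : Rpoly) :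
    fischer f f =
      ((∑ m ∈ f.support, (monoFactorial m : ℝ) * Complex.normSq (coeff m f) : ℝ) : ℂ) := by
  rw [fischer, Complex.ofReal_sum]
  refine Finset.sum_congr rfl fun m _ => ?_
  rw [Complex.ofReal_mul, Complex.normSq_eq_conj_mul_self]
  simp

lemma fischer_self_eq_zero {f : Rpoly} (h : fischer f f = 0) : f = 0 := by
  rw [fischer_self, Complex.ofReal_eq_zero, Finset.sum_eq_zero_iff_of_nonneg
    fun m _ => mul_nonneg (Nat.cast_nonneg _) (Complex.normSq_nonneg _)] at h
  by_contra hf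
  obtain ⟨m, hm⟩ := support_nonempty.mpr hf
  have := h m hm
  have h1 : (monoFactorial m : ℝ) ≠ 0 := by exact_mod_cast (monoFactorial_pos m).ne'
  rw [mul_eq_zero, or_iff_right h1, Complex.normSq_eq_zero] at this
  exact (mem_support_iff.mp hm) this

/-- The Fischer inner product as an inner product space core. -/
abbrev fischerCore : InnerProductSpace.Core ℂ Rpoly where
  inner := fischer
  conj_inner_symm f g := fischer_conj_symm f g
  re_inner_nonneg f := by
    rw [fischer_self]
    exact Finset.sum_nonneg fun m _ => mul_nonneg (Nat.cast_nonneg _) (Complex.normSq_nonneg _)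
  add_left := fischer_add_left
  smul_left f g c := fischer_smul_left c f g
  definite _ := fischer_self_eq_zero

lemma exists_fischer_orthogonal (U : Submodule ℂ Rpoly) [FiniteDimensional ℂ U] (x : Rpoly) :
    ∃ u ∈ U, ∀ v ∈ U, fischer v (x - u) = 0 := by
  let _ : NormedAddCommGroup Rpoly := fischerCore.toNormedAddCommGroup
  let _ : InnerProductSpace ℂ Rpoly := InnerProductSpace.ofCore fischerCore.toCore
  obtain ⟨w, hw, hxw⟩ := Submodule.HasOrthogonalProjection.exists_orthogonal (K := U) x
  exact ⟨w, hw, fun v hv => hxw v hv⟩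

lemma fischer_add_right (f g g' : Rpoly) :
    fischer f (g + g') = fischer f g + fischer f g' := by
  rw [← fischer_conj_symm f, fischer_add_left, map_add, fischer_conj_symm, fischer_conj_symm]

lemma fischer_smul_right (c : ℂ) (f g : Rpoly) : fischer f (c • g) = c * fischer f g := by
  rw [← fischer_conj_symm f, fischer_smul_left, map_mul, fischer_conj_symm, Complex.conj_conj]

lemma fischer_zero_left (g : Rpoly) : fischer 0 g = 0 := by simp [fischer]

lemma fischer_zero_right (f : Rpoly) : fischer f 0 = 0 := by simp [fischer]

lemma fischer_sum_left {ι : Type*} (S : Finset ι) (f : ι → Rpoly) (g : Rpoly) :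
    fischer (∑ i ∈ S, f i) g = ∑ i ∈ S, fischer (f i) g := by
  classical
  induction S using Finset.induction_on with
  | empty => simp [fischer_zero_left]
  | insert i S hi ih => rw [Finset.sum_insert hi, Finset.sum_insert hi, fischer_add_left, ih]

lemma fischer_sum_right {ι : Type*} (S : Finset ι) (f : Rpoly) (g : ι → Rpoly) :
    fischer f (∑ i ∈ S, g i) = ∑ i ∈ S, fischer f (g i) := by
  classical
  induction S using Finset.induction_on with
  | empty => simp [fischer_zero_right]
  | insert i S hi ih => rw [Finset.sum_insert hi, Finset.sum_insert hi, fischer_add_right, ih]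

lemma fischer_X_mul_left (p : ℕ × ℕ) (f g : Rpoly) :
    fischer (X p * f) g = fischer f (pderiv p g) := by
  classical
  rw [fischer, fischer, support_X_mul, Finset.sum_map]
  refine Finset.sum_congr rfl fun m _ => ?_
  rw [addLeftEmbedding_apply, coeff_X_mul, coeff_pderiv, add_comm, monoFactorial_add_single]
  push_cast
  ring

lemma fischer_X_mul_right (p : ℕ × ℕ) (f g : Rpoly) :
    fischer f (X p * g) = fischer (pderiv p f) g := by
  rw [← fischer_conj_symm f, fischer_X_mul_left, fischer_conj_symm]

lemma fischer_X_mul_pderiv (p q : ℕ × ℕ) (f g : Rpoly) :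
    fischer (X p * pderiv q f) g = fischer f (X q * pderiv p g) := by
  rw [fischer_X_mul_left, fischer_X_mul_right]

/-! ### Vanishing of all partial derivatives at a point -/

/-- All partial derivatives of `f` of order less than `d` vanish at `a`. -/
def VanishesToOrder (a : ℕ × ℕ → ℂ) : ℕ → Rpoly → Prop
  | 0, _ => True
  | d + 1, f => eval a f = 0 ∧ ∀ p, VanishesToOrder a d (pderiv p f)

lemma VanishesToOrder.zero (a : ℕ × ℕ → ℂ) (d : ℕ) : VanishesToOrder a d 0 := by
  induction d with
  | zero => trivial
  | succ d ih => exact ⟨map_zero _, fun p => by rwa [map_zero]⟩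

lemma VanishesToOrder.add {a : ℕ × ℕ → ℂ} {d : ℕ} :
    ∀ {f g : Rpoly}, VanishesToOrder a d f → VanishesToOrder a d g →
      VanishesToOrder a d (f + g) := by
  induction d with
  | zero => exact fun _ _ => trivial
  | succ d ih =>
    intro f g hf hg
    refine ⟨by rw [map_add, hf.1, hg.1, add_zero], fun p => ?_⟩
    rw [map_add]
    exact ih (hf.2 p) (hg.2 p)

lemma VanishesToOrder.smul {a : ℕ × ℕ → ℂ} {d : ℕ} (c : ℂ) :
    ∀ {f : Rpoly}, VanishesToOrder a d f → VanishesToOrder a d (c • f) := by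
  induction d with
  | zero => exact fun _ => trivial
  | succ d ih =>
    intro f hf
    refine ⟨by rw [smul_eval, hf.1, mul_zero], fun p => ?_⟩
    rw [Derivation.map_smul]
    exact ih (hf.2 p)

lemma VanishesToOrder.sum {ι : Type*} {a : ℕ × ℕ → ℂ} {d : ℕ} (S : Finset ι) (f : ι → Rpoly)
    (h : ∀ i ∈ S, VanishesToOrder a d (f i)) : VanishesToOrder a d (∑ i ∈ S, f i) :=
  Finset.sum_induction f _ (fun _ _ => VanishesToOrder.add) (VanishesToOrder.zero a d) h

lemma VanishesToOrder.X_sub_C_mul {a : ℕ × ℕ → ℂ} {d : ℕ} (q : ℕ × ℕ) :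
    ∀ {f : Rpoly}, VanishesToOrder a d f → VanishesToOrder a (d + 1) ((X q - C (a q)) * f) := by
  classical
  induction d with
  | zero => exact fun _ => ⟨by simp, fun _ => trivial⟩
  | succ d ih =>
    intro f hf
    refine ⟨by simp, fun p => ?_⟩
    have : pderiv p ((X q - C (a q)) * f) =
        (Pi.single p 1 : ℕ × ℕ → ℂ) q • f + (X q - C (a q)) * pderiv p f := by
      rw [pderiv_mul, map_sub, pderiv_C, pderiv_X, sub_zero]
      by_cases h : q = p
      · subst h; simp
      · simp [h]
    rw [this]
    exact (hf.smul _).add (ih (hf.2 p))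

lemma degree_lt_of_mem_support_pderiv {p : ℕ × ℕ} {f : Rpoly} {m : ℕ × ℕ →₀ ℕ}
    (hm : m ∈ (pderiv p f).support) : m + Finsupp.single p 1 ∈ f.support := by
  rw [mem_support_iff, coeff_pderiv] at hm
  exact mem_support_iff.mpr (left_ne_zero_of_mul hm)

lemma eq_zero_of_vanishesToOrder {a : ℕ × ℕ → ℂ} {d : ℕ} :
    ∀ {f : Rpoly}, f.totalDegree < d → VanishesToOrder a d f → f = 0 := by
  induction d with
  | zero => exact fun h => absurd h (Nat.not_lt_zero _)
  | succ d ih =>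
    intro f hd hf
    have hcoeff : ∀ m : ℕ × ℕ →₀ ℕ, m ≠ 0 → coeff m f = 0 := by
      intro m hm
      obtain ⟨p, hp⟩ := Finsupp.ne_iff.mp hm
      obtain ⟨u, rfl⟩ : ∃ u, m = u + Finsupp.single p 1 :=
        ⟨m - Finsupp.single p 1, (tsub_add_cancel_of_le (by
          rw [Finsupp.single_le_iff]; exact Nat.one_le_iff_ne_zero.mpr hp)).symm⟩
      by_contra hc
      have hdeg : (pderiv p f).totalDegree < d := by
        have hne : pderiv p f ≠ 0 := by
          intro h0
          have h1 := coeff_pderiv (i := p) f u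
          rw [h0, coeff_zero] at h1
          have h2 : ((u p : ℂ) + 1) ≠ 0 := Nat.cast_add_one_ne_zero _
          simp_all
        obtain ⟨v, hv, hv'⟩ := exists_mem_eq_sup _ (support_nonempty.mpr hne)
          fun s => s.sum fun _ e => e
        have h3 := le_totalDegree (degree_lt_of_mem_support_pderiv hv)
        rw [Finsupp.sum_add_index' (fun _ => rfl) (fun _ _ _ => rfl),
          Finsupp.sum_single_index rfl] at h3
        rw [totalDegree, hv']
        omega
      have h0 := ih hdeg (hf.2 p)
      have h1 := coeff_pderiv (i := p) f u
      rw [h0, coeff_zero] at h1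
      have h2 : ((u p : ℂ) + 1) ≠ 0 := Nat.cast_add_one_ne_zero _
      simp_all
    have hC : f = C (coeff 0 f) := by
      ext m
      rw [coeff_C]
      split_ifs with h
      · rw [← h]
      · exact hcoeff m (Ne.symm h)
    have := hf.1
    rw [hC, eval_C] at this
    rw [hC, this, C_0]

lemma derivation_sum_apply {ι : Type*} (S : Finset ι) (D : ι → Derivation ℂ Rpoly Rpoly)
    (f : Rpoly) : (∑ i ∈ S, D i) f = ∑ i ∈ S, D i f := by
  classical
  induction S using Finset.induction_on with
  | empty => simp
  | insert i S hi ih => rw [Finset.sum_insert hi, Finset.sum_insert hi, Derivation.add_apply, ih]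

/-- The polarization operator replacing the variables of column `j` by those of column `i`,
in rows `1, ..., n`. -/
def colPolarization (n i j : ℕ) : Derivation ℂ Rpoly Rpoly :=
  ∑ r ∈ Finset.Icc 1 n, (X (r, i) : Rpoly) • pderiv (r, j)

lemma colPolarization_apply (n i j : ℕ) (f : Rpoly) :
    colPolarization n i j f = ∑ r ∈ Finset.Icc 1 n, X (r, i) * pderiv (r, j) f := by
  simp [colPolarization, derivation_sum_apply]

lemma fischer_colPolarization (n i j : ℕ) (f g : Rpoly) :
    fischer (colPolarization n i j f) g = fischer f (colPolarization n j i g) := by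
  rw [colPolarization_apply, colPolarization_apply, fischer_sum_left, fischer_sum_right]
  exact Finset.sum_congr rfl fun r _ => fischer_X_mul_pderiv _ _ _ _

/-- The matrix with ones just above the diagonal and zeros elsewhere. -/
def superdiag (p : ℕ × ℕ) : ℂ := if p.2 = p.1 + 1 then 1 else 0

/-- The rows and columns of the generic `n × (n + 1)` matrix. -/
def genericBox (n : ℕ) : Finset (ℕ × ℕ) := Finset.Icc 1 n ×ˢ Finset.Icc 1 (n + 1)

lemma eq_zero_of_mem_invariant {n : ℕ} {K : Submodule ℂ Rpoly}
    (hinv : ∀ i ∈ Finset.Icc 1 (n + 1), ∀ j ∈ Finset.Icc 1 (n + 1), ∀ f ∈ K,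
      colPolarization n i j f ∈ K)
    (hbox : ∀ p ∉ genericBox n, ∀ f ∈ K, pderiv p f = 0)
    (heval : ∀ f ∈ K, eval superdiag f = 0) {f : Rpoly} (hf : f ∈ K) : f = 0 := by
  suffices h : ∀ d, ∀ f ∈ K, VanishesToOrder superdiag (d + 1) f from
    eq_zero_of_vanishesToOrder (Nat.lt_succ_self _) (h _ f hf)
  intro d
  induction d with
  | zero => exact fun f hf => ⟨heval f hf, fun _ => trivial⟩
  | succ d ih =>
    intro f hf
    refine ⟨heval f hf, fun p => ?_⟩
    by_cases hp : p ∈ genericBox n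
    · obtain ⟨r, t⟩ := p
      simp only [genericBox, Finset.mem_product, Finset.mem_Icc] at hp
      have hE := ih _ (hinv (r + 1) (by simp; omega) t (by simp; omega) f hf)
      have key : pderiv (r, t) f = colPolarization n (r + 1) t f + (-1 : ℂ) •
          ∑ r' ∈ Finset.Icc 1 n,
            (X (r', r + 1) - C (superdiag (r', r + 1))) * pderiv (r', t) f := by
        rw [colPolarization_apply, neg_one_smul, ← sub_eq_add_neg, ← Finset.sum_sub_distrib,
          Finset.sum_eq_single r]
        · simp only [superdiag, if_true, C_1]
          ring
        · intro r' _ hr'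
          simp [superdiag, Ne.symm hr']
        · intro h
          simp at h
          omega
      rw [key]
      refine hE.add (VanishesToOrder.smul _ (VanishesToOrder.sum _ _ fun r' _ => ?_))
      exact VanishesToOrder.X_sub_C_mul _ ((ih f hf).2 (r', t))
    · rw [hbox p hp f hf]
      exact VanishesToOrder.zero _ _

/-! ### Derivations and determinants -/

lemma derivation_prod {ι : Type*} [DecidableEq ι] (D : Derivation ℂ Rpoly Rpoly) (S : Finset ι)
    (f : ι → Rpoly) :
    D (∏ i ∈ S, f i) = ∑ b ∈ S, ∏ i ∈ S, if i = b then D (f i) else f i := by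
  induction S using Finset.induction_on with
  | empty => simp
  | insert a S ha ih =>
    have hne : ∀ i ∈ S, i ≠ a := fun i hi h => ha (h ▸ hi)
    rw [Finset.prod_insert ha, Derivation.leibniz, ih, Finset.sum_insert ha,
      Finset.prod_insert ha, if_pos rfl, Finset.prod_congr rfl fun i hi => if_neg (hne i hi),
      smul_eq_mul, smul_eq_mul, Finset.mul_sum, add_comm, mul_comm (∏ i ∈ S, f i)]
    congr 1
    refine Finset.sum_congr rfl fun b hb => ?_
    rw [Finset.prod_insert ha, if_neg (hne b hb).symm]

lemma derivation_det_updateCol (D : Derivation ℂ Rpoly Rpoly) {s : ℕ}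
    (A : Matrix (Fin s) (Fin s) Rpoly) :
    D A.det = ∑ b, (A.updateCol b fun a => D (A a b)).det := by
  simp_rw [Matrix.det_apply']
  rw [Finset.sum_comm, map_sum]
  refine Finset.sum_congr rfl fun σ _ => ?_
  rw [Derivation.leibniz, derivation_prod, Derivation.map_intCast, smul_zero, add_zero,
    smul_eq_mul, Finset.mul_sum]
  refine Finset.sum_congr rfl fun b _ => ?_
  congr 1
  refine Finset.prod_congr rfl fun i _ => ?_
  rw [Matrix.updateCol_apply]
  split_ifs with h
  · rw [h]
  · rfl

lemma derivation_det_updateRow (D : Derivation ℂ Rpoly Rpoly) {s : ℕ}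
    (A : Matrix (Fin s) (Fin s) Rpoly) :
    D A.det = ∑ a, (A.updateRow a fun b => D (A a b)).det := by
  rw [← Matrix.det_transpose, derivation_det_updateCol]
  refine Finset.sum_congr rfl fun a _ => ?_
  rw [Matrix.updateCol_transpose, Matrix.det_transpose]
  rfl

/-! ### Minors -/

/-- The minor of an array with rows `j, ..., j + s - 1` and columns `Θ`. -/
def minor (z : ℕ → ℕ → Rpoly) (j s : ℕ) (Θ : Fin s → ℕ) : Rpoly :=
  Matrix.det (Matrix.of fun a b : Fin s => z (j + a.1) (Θ b))

/-- The array of independent variables. -/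
def genericArray (r t : ℕ) : Rpoly := X (r, t)

lemma minor_comp_perm (z : ℕ → ℕ → Rpoly) (j s : ℕ) (Θ : Fin s → ℕ) (σ : Equiv.Perm (Fin s)) :
    minor z j s (Θ ∘ σ) = (Equiv.Perm.sign σ : ℂ) • minor z j s Θ := by
  have := Matrix.det_permute' σ (Matrix.of fun a b : Fin s => z (j + a.1) (Θ b))
  rw [minor, minor, Algebra.smul_def, map_intCast]
  exact this

lemma minor_eq_zero_of_not_injective (z : ℕ → ℕ → Rpoly) (j s : ℕ) {Θ : Fin s → ℕ}
    (h : ¬ Function.Injective Θ) : minor z j s Θ = 0 := by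
  simp only [Function.Injective, not_forall] at h
  obtain ⟨b, b', h1, h2⟩ := h
  exact Matrix.det_zero_of_column_eq h2 fun a => by simp [h1]

lemma colPolarization_X {n i j r t : ℕ} (hr : r ∈ Finset.Icc 1 n) :
    colPolarization n i j (X (r, t)) = if t = j then X (r, i) else 0 := by
  classical
  rw [colPolarization_apply, Finset.sum_eq_single r]
  · split_ifs with h
    · simp [h]
    · rw [pderiv_X_of_ne (by simpa using h), mul_zero]
  · intro r' _ h
    rw [pderiv_X_of_ne (by simpa using fun h' => absurd h'.symm h), mul_zero]
  · exact fun h => absurd hr h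

lemma colPolarization_minor {n i i' j s : ℕ} (hj : 1 ≤ j) (hs : j + s ≤ n + 1)
    (Θ : Fin s → ℕ) :
    colPolarization n i i' (minor genericArray j s Θ) =
      ∑ b, if Θ b = i' then minor genericArray j s (Function.update Θ b i) else 0 := by
  rw [minor, derivation_det_updateCol]
  refine Finset.sum_congr rfl fun b _ => ?_
  have hrow : ∀ a : Fin s, j + a.1 ∈ Finset.Icc 1 n := fun a => by
    have := a.2
    simp only [Finset.mem_Icc]; omega
  split_ifs with h
  · rw [minor]
    congr 1
    ext1 a c
    rw [Matrix.updateCol_apply]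
    split_ifs with hc
    · subst hc
      simp [genericArray, colPolarization_X (hrow a), h]
    · simp [hc]
  · refine Matrix.det_eq_zero_of_column_eq_zero b fun a => ?_
    simp [genericArray, colPolarization_X (hrow a), h]

/-- The polarization operator replacing the variables of row `s` by those of row `r`,
in columns `1, ..., n + 1`. -/
def rowPolarization (n r s : ℕ) : Derivation ℂ Rpoly Rpoly :=
  ∑ t ∈ Finset.Icc 1 (n + 1), (X (r, t) : Rpoly) • pderiv (s, t)

lemma rowPolarization_X {n r s q t : ℕ} (ht : t ∈ Finset.Icc 1 (n + 1)) :
    rowPolarization n r s (X (q, t)) = if q = s then X (r, t) else 0 := by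
  classical
  rw [rowPolarization, derivation_sum_apply, Finset.sum_eq_single t]
  · split_ifs with h
    · simp [h]
    · rw [Derivation.smul_apply, pderiv_X_of_ne (by simpa using h), smul_zero]
  · intro t' _ h
    rw [Derivation.smul_apply, pderiv_X_of_ne (by simpa using fun _ => Ne.symm h), smul_zero]
  · exact fun h => absurd ht h

lemma rowPolarization_minor {n q r j s : ℕ} {Θ : Fin s → ℕ}
    (hΘ : ∀ b, Θ b ∈ Finset.Icc 1 (n + 1)) (hq : j ≤ q → q < j + s) (hqr : q ≤ r)
    (hr : r < j + s) :
    rowPolarization n r q (minor genericArray j s Θ) =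
      (if r = q ∧ j ≤ q then (1 : ℂ) else 0) • minor genericArray j s Θ := by
  rw [minor, derivation_det_updateRow]
  have hentry : ∀ a b, rowPolarization n r q
      (Matrix.of (fun a b : Fin s => genericArray (j + a.1) (Θ b)) a b) =
        if j + a.1 = q then X (r, Θ b) else 0 := fun a b => by
    rw [Matrix.of_apply, genericArray, rowPolarization_X (hΘ b)]
  simp_rw [hentry]
  by_cases hjq : j ≤ q
  · obtain ⟨a₀, ha₀⟩ : ∃ a : Fin s, j + a.1 = q :=
      ⟨⟨q - j, by have := hq hjq; omega⟩, by simp; omega⟩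
    rw [Finset.sum_eq_single a₀]
    · simp only [if_pos ha₀]
      split_ifs with h
      · obtain ⟨rfl, -⟩ := h
        rw [one_smul]
        congr 1
        ext1 a b
        rw [Matrix.updateRow_apply]
        split_ifs with ha
        · subst ha
          simp only [Matrix.of_apply, genericArray, ha₀]
        · rfl
      · rw [zero_smul]
        obtain ⟨a₁, ha₁⟩ : ∃ a : Fin s, j + a.1 = r := ⟨⟨r - j, by omega⟩, by simp; omega⟩
        have hne : a₀ ≠ a₁ := by
          rintro rfl
          exact h ⟨ha₁.symm.trans ha₀, hjq⟩
        refine Matrix.det_zero_of_row_eq hne ?_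
        ext1 b
        rw [Matrix.updateRow_self, Matrix.updateRow_ne hne.symm]
        simp only [Matrix.of_apply, genericArray, ha₁]
    · intro a _ ha
      refine Matrix.det_eq_zero_of_row_eq_zero a fun b => ?_
      rw [Matrix.updateRow_self, if_neg]
      intro h
      exact ha (Fin.ext (by omega))
    · exact fun h => absurd (Finset.mem_univ _) h
  · rw [if_neg (fun h => hjq h.2), zero_smul]
    refine Finset.sum_eq_zero fun a _ => Matrix.det_eq_zero_of_row_eq_zero a fun b => ?_
    rw [Matrix.updateRow_self, if_neg (by omega)]

lemma pderiv_minor_eq_zero {n j s : ℕ} {Θ : Fin s → ℕ} (hj : 1 ≤ j) (hs : j + s ≤ n + 1)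
    (hΘ : ∀ b, Θ b ∈ Finset.Icc 1 (n + 1)) {p : ℕ × ℕ} (hp : p ∉ genericBox n) :
    pderiv p (minor genericArray j s Θ) = 0 := by
  rw [minor, derivation_det_updateRow]
  refine Finset.sum_eq_zero fun a _ => Matrix.det_eq_zero_of_row_eq_zero a fun b => ?_
  rw [Matrix.updateRow_self, Matrix.of_apply, genericArray, pderiv_X_of_ne]
  rintro rfl
  apply hp
  have := a.2
  have := hΘ b
  simp only [genericBox, Finset.mem_product, Finset.mem_Icc] at *
  omega

/-! ### Spans of products of minors -/

lemma prod_pow_rel {α β ι : Type*} [CommMonoid α] [CommMonoid β] {P : α → β → Prop}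
    (h1 : P 1 1) (hmul : ∀ a b a' b', P a b → P a' b' → P (a * a') (b * b'))
    {S : Finset ι} {f : ι → α} {g : ι → β} (κ : ι → ℕ) (h : ∀ j ∈ S, P (f j) (g j)) :
    P (∏ j ∈ S, f j ^ κ j) (∏ j ∈ S, g j ^ κ j) := by
  classical
  have hpow : ∀ {a b}, P a b → ∀ m : ℕ, P (a ^ m) (b ^ m) := by
    intro a b hab m
    induction m with
    | zero => simpa using h1
    | succ m ih => rw [pow_succ, pow_succ]; exact hmul _ _ _ _ ih hab
  induction S using Finset.induction_on with
  | empty => simpa using h1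
  | insert i S hi ih =>
    rw [Finset.prod_insert hi, Finset.prod_insert hi]
    exact hmul _ _ _ _ (hpow (h i (Finset.mem_insert_self _ _)) _)
      (ih fun j hj => h j (Finset.mem_insert_of_mem hj))

/-- The span of the minors with rows `j, ..., n` of the generic matrix. -/
def minorSpan (n j : ℕ) : Submodule ℂ Rpoly :=
  Submodule.span ℂ {f | ∃ Θ : Fin (n - j + 1) → ℕ,
    (∀ b, Θ b ∈ Finset.Icc 1 (n + 1)) ∧ minor genericArray j (n - j + 1) Θ = f}

/-- The span of the products of `k (n - j + 1)` minors with rows `j, ..., n`, for all `j`. -/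
def minorProducts (n : ℕ) (k : ℕ → ℕ) : Submodule ℂ Rpoly :=
  ∏ j ∈ Finset.Icc 1 n, minorSpan n j ^ k (n - j + 1)

lemma minorProducts_fg (n : ℕ) (k : ℕ → ℕ) : (minorProducts n k).FG := by
  have hfg : ∀ j ∈ Finset.Icc 1 n, (minorSpan n j).FG := by
    intro j _
    refine Submodule.fg_span (((Fintype.piFinset fun _ : Fin (n - j + 1) =>
      Finset.Icc 1 (n + 1)).image (minor genericArray j (n - j + 1))).finite_toSet.subset ?_)
    rintro f ⟨Θ, hΘ, rfl⟩
    exact Finset.mem_coe.mpr (Finset.mem_image_of_mem _ (Fintype.mem_piFinset.mpr hΘ))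
  exact prod_pow_rel (P := fun (A : Submodule ℂ Rpoly) (_ : Submodule ℂ Rpoly) => A.FG)
    (g := fun _ => 1) (by rw [Submodule.one_eq_span]; exact Submodule.fg_span_singleton 1)
    (fun _ _ _ _ h h' => h.mul h') _ hfg

lemma derivation_mem_minorProducts {n : ℕ} (k : ℕ → ℕ) (D : Derivation ℂ Rpoly Rpoly)
    (hD : ∀ j ∈ Finset.Icc 1 n, ∀ f ∈ minorSpan n j, D f ∈ minorSpan n j) :
    ∀ f ∈ minorProducts n k, D f ∈ minorProducts n k := by
  refine prod_pow_rel (P := fun A (_ : Submodule ℂ Rpoly) => ∀ f ∈ A, D f ∈ A)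
    (g := fun _ => 1) ?_ ?_ _ hD
  · rintro f ⟨c, rfl⟩
    simp
  · intro A _ B _ hA hB f hf
    induction hf using Submodule.mul_induction_on' with
    | mem_mul_mem a ha b hb =>
      rw [Derivation.leibniz, smul_eq_mul, smul_eq_mul, mul_comm b]
      exact add_mem (Submodule.mul_mem_mul ha (hB b hb)) (Submodule.mul_mem_mul (hA a ha) hb)
    | add a _ b _ h h' => rw [map_add]; exact add_mem h h'

lemma derivation_eq_smul_of_mem_minorProducts {n : ℕ} (k : ℕ → ℕ)
    (D : Derivation ℂ Rpoly Rpoly) (μ : ℕ → ℂ)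
    (hD : ∀ j ∈ Finset.Icc 1 n, ∀ f ∈ minorSpan n j, D f = μ j • f) :
    ∀ f ∈ minorProducts n k, D f = (∑ j ∈ Finset.Icc 1 n, k (n - j + 1) * μ j) • f := by
  have h := prod_pow_rel
    (P := fun (A : Submodule ℂ Rpoly) (c : Multiplicative ℂ) => ∀ f ∈ A, D f = c.toAdd • f)
    (f := minorSpan n) (g := fun j => Multiplicative.ofAdd (μ j)) (S := Finset.Icc 1 n)
    ?_ ?_ (fun j => k (n - j + 1)) hD
  · simpa [toAdd_prod, minorProducts] using h
  · rintro f ⟨c, rfl⟩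
    simp
  · intro A a B b hA hB f hf
    induction hf using Submodule.mul_induction_on' with
    | mem_mul_mem x hx y hy =>
      rw [Derivation.leibniz, hA x hx, hB y hy, toAdd_mul, smul_eq_mul, smul_eq_mul,
        mul_smul_comm, mul_smul_comm, mul_comm y, ← add_smul, add_comm]
    | add x _ y _ h h' => rw [map_add, h, h', smul_add]

lemma colPolarization_mem_minorProducts {n : ℕ} (k : ℕ → ℕ) {i i' : ℕ}
    (hi : i ∈ Finset.Icc 1 (n + 1)) :
    ∀ f ∈ minorProducts n k, colPolarization n i i' f ∈ minorProducts n k := by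
  refine derivation_mem_minorProducts k _ fun j hj f hf => ?_
  rw [Finset.mem_Icc] at hj
  induction hf using Submodule.span_induction with
  | mem f hf =>
    obtain ⟨Θ, hΘ, rfl⟩ := hf
    rw [colPolarization_minor hj.1 (by omega)]
    refine Submodule.sum_mem _ fun b _ => ?_
    split_ifs
    · refine Submodule.subset_span ⟨_, fun c => ?_, rfl⟩
      rw [Function.update_apply]
      split_ifs
      exacts [hi, hΘ c]
    · exact zero_mem _
  | zero => rw [map_zero]; exact zero_mem _
  | add f g _ _ h h' => rw [map_add]; exact add_mem h h'
  | smul c f _ h => rw [Derivation.map_smul]; exact Submodule.smul_mem _ _ h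

lemma derivation_eq_smul_of_mem_minorSpan {n j : ℕ} {D : Derivation ℂ Rpoly Rpoly} {c : ℂ}
    (h : ∀ Θ : Fin (n - j + 1) → ℕ, (∀ b, Θ b ∈ Finset.Icc 1 (n + 1)) →
      D (minor genericArray j (n - j + 1) Θ) = c • minor genericArray j (n - j + 1) Θ) :
    ∀ f ∈ minorSpan n j, D f = c • f := by
  intro f hf
  induction hf using Submodule.span_induction with
  | mem f hf =>
    obtain ⟨Θ, hΘ, rfl⟩ := hf
    exact h Θ hΘ
  | zero => simp
  | add f g _ _ h h' => rw [map_add, smul_add, h, h']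
  | smul a f _ h => rw [Derivation.map_smul, h, smul_comm]

lemma pderiv_eq_zero_of_mem_minorProducts {n : ℕ} (k : ℕ → ℕ) {p : ℕ × ℕ}
    (hp : p ∉ genericBox n) : ∀ f ∈ minorProducts n k, pderiv p f = 0 := by
  intro f hf
  have := derivation_eq_smul_of_mem_minorProducts k (pderiv p) (fun _ => 0)
    (fun j hj => derivation_eq_smul_of_mem_minorSpan fun Θ hΘ => by
      rw [Finset.mem_Icc] at hj
      rw [pderiv_minor_eq_zero hj.1 (by omega) hΘ hp, zero_smul]) f hf
  simpa using this

/-- The degree in the variables of row `q` of the products of minors. -/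
def rowDegree (n : ℕ) (k : ℕ → ℕ) (q : ℕ) : ℂ := ∑ j ∈ Finset.Icc 1 q, (k (n - j + 1) : ℂ)

lemma rowPolarization_eq_of_mem_minorProducts {n : ℕ} (k : ℕ → ℕ) {q r : ℕ}
    (hqr : q ≤ r) (hr : r ≤ n) : ∀ f ∈ minorProducts n k,
      rowPolarization n r q f = (if r = q then rowDegree n k q else 0) • f := by
  intro f hf
  rw [derivation_eq_smul_of_mem_minorProducts k (rowPolarization n r q)
    (fun j => if r = q ∧ j ≤ q then (1 : ℂ) else 0)
    (fun j hj => derivation_eq_smul_of_mem_minorSpan fun Θ hΘ => by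
      rw [Finset.mem_Icc] at hj
      exact rowPolarization_minor hΘ (by omega) hqr (by omega)) f hf]
  congr 1
  split_ifs with h
  · subst h
    rw [rowDegree]
    symm
    refine Finset.sum_subset_zero_on_sdiff (Finset.Icc_subset_Icc le_rfl hr) ?_ ?_
    · intro j hj
      simp only [Finset.mem_sdiff, Finset.mem_Icc] at hj
      simp
      omega
    · intro j hj
      simp [(Finset.mem_Icc.mp hj).2]
  · simp [h]

/-! ### The monomials of maximal weight -/

/-- The weight of a monomial is the sum of the column indices of its variables. -/
def colWeight : (ℕ × ℕ →₀ ℕ) →+ ℕ := Finsupp.weight (Prod.snd : ℕ × ℕ → ℕ)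

/-- `A` consists of scalar multiples of `v`, which is homogeneous of weight `w` and takes the
value `1` at the superdiagonal matrix, modulo polynomials of smaller weight that vanish there. -/
def HasLeadingTerm (A : Submodule ℂ Rpoly) (v : Rpoly × Multiplicative ℕ) : Prop :=
  IsWeightedHomogeneous (Prod.snd : ℕ × ℕ → ℕ) v.1 v.2.toAdd ∧ eval superdiag v.1 = 1 ∧
    ∀ f ∈ A, ∃ c : ℂ, (∀ m ∈ (f - c • v.1).support, colWeight m < v.2.toAdd) ∧
      eval superdiag (f - c • v.1) = 0

lemma colWeight_lt_of_mem_support_mul {f g : Rpoly} {a b : ℕ}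
    (hf : ∀ m ∈ f.support, colWeight m < a) (hg : ∀ m ∈ g.support, colWeight m ≤ b) :
    ∀ m ∈ (f * g).support, colWeight m < a + b := by
  classical
  intro m hm
  obtain ⟨u, hu, v, hv, rfl⟩ := Finset.mem_add.mp (support_mul f g hm)
  rw [map_add]
  exact add_lt_add_of_lt_of_le (hf u hu) (hg v hv)

lemma HasLeadingTerm.one : HasLeadingTerm 1 1 := by
  refine ⟨isWeightedHomogeneous_one ℂ _, map_one _, ?_⟩
  rintro f ⟨c, rfl⟩
  refine ⟨c, ?_⟩
  have : LinearMap.toSpanSingleton ℂ Rpoly 1 c - c • (1 : Rpoly × Multiplicative ℕ).1 = 0 := by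
    simp
  rw [this]
  simp

lemma HasLeadingTerm.mul {A B : Submodule ℂ Rpoly} {v w : Rpoly × Multiplicative ℕ}
    (hA : HasLeadingTerm A v) (hB : HasLeadingTerm B w) :
    HasLeadingTerm (A * B) (v * w) := by
  classical
  obtain ⟨hA1, hA2, hA3⟩ := hA
  obtain ⟨hB1, hB2, hB3⟩ := hB
  refine ⟨hA1.mul hB1, by rw [Prod.fst_mul, map_mul, hA2, hB2, one_mul], ?_⟩
  intro f hf
  induction hf using Submodule.mul_induction_on' with
  | mem_mul_mem x hx y hy =>
    obtain ⟨c, hc, hc'⟩ := hA3 x hx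
    obtain ⟨d, hd, hd'⟩ := hB3 y hy
    refine ⟨c * d, ?_⟩
    have hv : ∀ m ∈ v.1.support, colWeight m ≤ v.2.toAdd := fun m hm =>
      (hA1 (mem_support_iff.mp hm)).le
    have hw : ∀ m ∈ w.1.support, colWeight m ≤ w.2.toAdd := fun m hm =>
      (hB1 (mem_support_iff.mp hm)).le
    have hy' : ∀ m ∈ y.support, colWeight m ≤ w.2.toAdd := fun m hm => by
      have : y = (y - d • w.1) + d • w.1 := by abel
      rw [this] at hm
      rcases Finset.mem_union.mp (support_add hm) with h | h
      · exact (hd m h).le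
      · exact hw m (support_smul h)
    have key : x * y - (c * d) • (v * w).1 =
        (x - c • v.1) * y + (y - d • w.1) * (c • v.1) := by
      rw [Prod.fst_mul, mul_smul, Algebra.smul_def, Algebra.smul_def, Algebra.smul_def,
        Algebra.smul_def]
      ring
    rw [key]
    refine ⟨fun m hm => ?_, by
      rw [map_add, map_mul, map_mul, hc', hd', zero_mul, zero_mul, add_zero]⟩
    rw [Prod.snd_mul, toAdd_mul]
    rcases Finset.mem_union.mp (support_add hm) with h | h
    · exact colWeight_lt_of_mem_support_mul hc hy' m h
    · rw [add_comm]
      exact colWeight_lt_of_mem_support_mul hd (fun m hm => hv m (support_smul hm)) m h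
  | add x _ y _ hx hy =>
    obtain ⟨c, hc, hc'⟩ := hx
    obtain ⟨d, hd, hd'⟩ := hy
    refine ⟨c + d, ?_⟩
    have key : x + y - (c + d) • (v * w).1 =
        (x - c • (v * w).1) + (y - d • (v * w).1) := by
      rw [add_smul]
      abel
    rw [key]
    refine ⟨fun m hm => ?_, by rw [map_add, hc', hd', add_zero]⟩
    rcases Finset.mem_union.mp (support_add hm) with h | h
    exacts [hc m h, hd m h]

lemma isWeightedHomogeneous_minor (j s : ℕ) (Θ : Fin s → ℕ) :
    IsWeightedHomogeneous (Prod.snd : ℕ × ℕ → ℕ) (minor genericArray j s Θ) (∑ b, Θ b) := by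
  rw [minor, Matrix.det_apply]
  refine IsWeightedHomogeneous.sum _ _ _ fun σ _ => ?_
  have h : IsWeightedHomogeneous (Prod.snd : ℕ × ℕ → ℕ)
      (∏ b, Matrix.of (fun a b : Fin s => genericArray (j + a.1) (Θ b)) (σ b) b) (∑ b, Θ b) :=
    IsWeightedHomogeneous.prod _ _ _ fun b _ => isWeightedHomogeneous_X ℂ _ _
  rcases Int.units_eq_one_or (Equiv.Perm.sign σ) with h1 | h1
  · rw [h1, one_smul]
    exact h
  · rw [h1, Units.neg_smul, one_smul]
    exact (weightedHomogeneousSubmodule ℂ _ _).neg_mem h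

lemma eval_superdiag_minor (j s : ℕ) (Θ : Fin s → ℕ) :
    eval superdiag (minor genericArray j s Θ) =
      Matrix.det (Matrix.of fun a b : Fin s => if Θ b = j + a.1 + 1 then (1 : ℂ) else 0) := by
  rw [minor, RingHom.map_det]
  congr 1
  ext a b
  simp [genericArray, superdiag]

lemma sum_lt_sum_Icc {n j : ℕ} {T : Finset ℕ} (hT : T ⊆ Finset.Icc 1 (n + 1))
    (hcard : T.card = (Finset.Icc (j + 1) (n + 1)).card) (hlow : ∃ t ∈ T, t ≤ j) :
    ∑ t ∈ T, t < ∑ t ∈ Finset.Icc (j + 1) (n + 1), t := by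
  classical
  set U := Finset.Icc (j + 1) (n + 1)
  rw [← Finset.sum_inter_add_sum_sdiff T U, ← Finset.sum_inter_add_sum_sdiff U T,
    Finset.inter_comm U T]
  refine Nat.add_lt_add_left ?_ _
  have hc : (T \ U).card = (U \ T).card := Finset.card_sdiff_comm hcard
  have hpos : 0 < (T \ U).card := by
    obtain ⟨t, ht, htj⟩ := hlow
    refine Finset.card_pos.mpr ⟨t, Finset.mem_sdiff.mpr ⟨ht, ?_⟩⟩
    simp only [U, Finset.mem_Icc]
    omega
  have h1 : ∑ t ∈ T \ U, t ≤ (T \ U).card • j := by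
    refine Finset.sum_le_card_nsmul _ _ _ fun t ht => ?_
    rw [Finset.mem_sdiff] at ht
    have := Finset.mem_Icc.mp (hT ht.1)
    have := ht.2
    simp only [U, Finset.mem_Icc] at this
    omega
  have h2 : (U \ T).card • (j + 1) ≤ ∑ t ∈ U \ T, t := by
    refine Finset.card_nsmul_le_sum _ _ _ fun t ht => ?_
    exact (Finset.mem_Icc.mp (Finset.mem_sdiff.mp ht).1).1
  rw [← hc] at h2
  simp only [smul_eq_mul] at h1 h2
  nlinarith

lemma hasLeadingTerm_minorSpan {n j : ℕ} (hj : j ∈ Finset.Icc 1 n) :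
    HasLeadingTerm (minorSpan n j)
      (minor genericArray j (n - j + 1) fun b => j + 1 + b.1,
        Multiplicative.ofAdd (∑ b : Fin (n - j + 1), (j + 1 + b.1))) := by
  classical
  rw [Finset.mem_Icc] at hj
  refine ⟨isWeightedHomogeneous_minor _ _ _, ?_, ?_⟩
  · have h : (Matrix.of fun a b : Fin (n - j + 1) =>
        if j + 1 + b.1 = j + a.1 + 1 then (1 : ℂ) else 0) = 1 := ?_
    · rw [eval_superdiag_minor, h, Matrix.det_one]
    ext a b
    rw [Matrix.of_apply, Matrix.one_apply]
    refine if_congr ?_ rfl rfl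
    rw [Fin.ext_iff]
    omega
  · intro f hf
    induction hf using Submodule.span_induction with
    | mem f hf =>
      obtain ⟨Θ, hΘ, rfl⟩ := hf
      by_cases hinj : Function.Injective Θ
      · by_cases hlow : ∃ b, Θ b ≤ j
        · refine ⟨0, ?_⟩
          rw [zero_smul, sub_zero]
          constructor
          · intro m hm
            rw [colWeight, isWeightedHomogeneous_minor _ _ _ (mem_support_iff.mp hm), toAdd_ofAdd]
            have hsum := sum_lt_sum_Icc (n := n) (j := j) (T := Finset.univ.image Θ) ?_ ?_ ?_
            · rw [Finset.sum_image hinj.injOn] at hsum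
              refine hsum.trans_eq ?_
              rw [Fin.sum_univ_eq_sum_range (fun b => j + 1 + b),
                ← Finset.Ico_add_one_right_eq_Icc, Finset.sum_Ico_eq_sum_range,
                show n + 1 + 1 - (j + 1) = n - j + 1 by omega]
            · intro t ht
              obtain ⟨b, -, rfl⟩ := Finset.mem_image.mp ht
              exact hΘ b
            · rw [Finset.card_image_of_injective _ hinj]
              simp
              omega
            · obtain ⟨b, hb⟩ := hlow
              exact ⟨Θ b, Finset.mem_image_of_mem _ (Finset.mem_univ _), hb⟩
          · obtain ⟨b, hb⟩ := hlow
            rw [eval_superdiag_minor]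
            refine Matrix.det_eq_zero_of_column_eq_zero b fun a => ?_
            rw [Matrix.of_apply, if_neg]
            omega
        · push Not at hlow
          have hbound : ∀ b, Θ b - (j + 1) < n - j + 1 := fun b => by
            have := Finset.mem_Icc.mp (hΘ b)
            omega
          have hσ : Function.Injective fun b => (⟨Θ b - (j + 1), hbound b⟩ : Fin (n - j + 1)) := by
            intro b b' h
            rw [Fin.mk.injEq] at h
            have := hlow b
            have := hlow b'
            exact hinj (by omega)
          obtain ⟨σ, hΘσ⟩ : ∃ σ : Equiv.Perm (Fin (n - j + 1)),
              Θ = (fun b : Fin (n - j + 1) => j + 1 + b.1) ∘ σ := by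
            refine ⟨Equiv.ofBijective _ (Finite.injective_iff_bijective.mp hσ), ?_⟩
            ext b
            have := hlow b
            simp
            omega
          refine ⟨(Equiv.Perm.sign σ : ℂ), ?_⟩
          rw [hΘσ, minor_comp_perm]
          simp
      · refine ⟨0, ?_⟩
        rw [minor_eq_zero_of_not_injective _ _ _ hinj]
        simp
    | zero => exact ⟨0, by simp⟩
    | add f g _ _ hf hg =>
      obtain ⟨c, hc, hc'⟩ := hf
      obtain ⟨d, hd, hd'⟩ := hg
      refine ⟨c + d, ?_⟩
      rw [add_smul, add_sub_add_comm]
      refine ⟨fun m hm => ?_, by rw [map_add, hc', hd', add_zero]⟩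
      rcases Finset.mem_union.mp (support_add hm) with h | h
      exacts [hc m h, hd m h]
    | smul a f _ hf =>
      obtain ⟨c, hc, hc'⟩ := hf
      refine ⟨a * c, ?_⟩
      rw [mul_smul, ← smul_sub]
      exact ⟨fun m hm => hc m (support_smul hm), by rw [smul_eval, hc', mul_zero]⟩

/-- The product of the minors with rows `j, ..., n` and columns `j + 1, ..., n + 1`. -/
def topProduct (n : ℕ) (k : ℕ → ℕ) : Rpoly :=
  ∏ j ∈ Finset.Icc 1 n, (minor genericArray j (n - j + 1) fun b => j + 1 + b.1) ^ k (n - j + 1)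

lemma eval_superdiag_eq_zero_of_fischer_eq_zero {n : ℕ} {k : ℕ → ℕ} {f : Rpoly}
    (hf : f ∈ minorProducts n k) (h : fischer (topProduct n k) f = 0) :
    eval superdiag f = 0 := by
  have hlead := prod_pow_rel HasLeadingTerm.one (fun _ _ _ _ => HasLeadingTerm.mul)
    (fun j => k (n - j + 1)) fun j hj => hasLeadingTerm_minorSpan (n := n) (j := j) hj
  obtain ⟨hhom, heval, hdec⟩ := hlead
  simp only [Prod.fst_prod, Prod.pow_fst] at hhom heval hdec
  change eval superdiag (topProduct n k) = 1 at heval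
  obtain ⟨c, hc, hc'⟩ := hdec f hf
  change ∀ m ∈ (f - c • topProduct n k).support, _ at hc
  change eval superdiag (f - c • topProduct n k) = 0 at hc'
  have horth : fischer (topProduct n k) (f - c • topProduct n k) = 0 := by
    refine Finset.sum_eq_zero fun m hm => ?_
    have : coeff m (f - c • topProduct n k) = 0 := by
      by_contra hne
      exact (hc m (mem_support_iff.mpr hne)).ne (hhom (mem_support_iff.mp hm))
    rw [this, mul_zero, mul_zero]
  have hsplit : f = (f - c • topProduct n k) + c • topProduct n k := by abel
  rw [hsplit, fischer_add_right, horth, zero_add, fischer_smul_right, mul_eq_zero] at h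
  rcases h with h | h
  · rw [h, zero_smul, sub_zero] at hc'
    exact hc'
  · rw [fischer_self_eq_zero h, map_zero] at heval
    exact absurd heval zero_ne_one

/-! ### Specialization of the generic matrix -/

/-- The specialization of the generic `n × (n + 1)` matrix to the array `Xv`. -/
def specialize (n : ℕ) : Rpoly →ₐ[ℂ] Rpoly :=
  aeval fun p => if p ∈ genericBox n then Xv p.1 p.2 else 0

lemma specialize_X {n s t : ℕ} (hs : s ∈ Finset.Icc 1 n) (ht : t ∈ Finset.Icc 1 (n + 1)) :
    specialize n (X (s, t)) = Xv s t := by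
  have h : (s, t) ∈ genericBox n := Finset.mem_product.mpr ⟨hs, ht⟩
  rw [specialize, aeval_X, if_pos h]

lemma specialize_X_of_notMem {n : ℕ} {p : ℕ × ℕ} (hp : p ∉ genericBox n) :
    specialize n (X p) = 0 := by
  rw [specialize, aeval_X, if_neg hp]

lemma specialize_minor {n j s : ℕ} {Θ : Fin s → ℕ} (hj : 1 ≤ j) (hs : j + s ≤ n + 1)
    (hΘ : ∀ b, Θ b ∈ Finset.Icc 1 (n + 1)) :
    specialize n (minor genericArray j s Θ) = minor Xv j s Θ := by
  rw [minor, minor, AlgHom.map_det]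
  congr 1
  ext1 a b
  have := a.2
  exact specialize_X (Finset.mem_Icc.mpr ⟨by omega, by omega⟩) (hΘ b)

lemma Xv_eq_zero {i j : ℕ} (h : i + 1 < j) : Xv i j = 0 := by
  rw [Xv, if_neg (by omega), if_neg (by omega)]

lemma Xv_succ (i : ℕ) : Xv i (i + 1) = -1 := by
  rw [Xv, if_neg (by omega), if_pos rfl]

lemma pderiv_Xv (p : ℕ × ℕ) (s t : ℕ) :
    pderiv p (Xv s t) = if p = (s, t) ∧ t ≤ s then 1 else 0 := by
  classical
  by_cases h : t ≤ s
  · simp [Xv, h, pderiv_X, Pi.single_apply, eq_comm]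
  · rw [if_neg fun h' => h h'.2, Xv, if_neg h]
    split_ifs <;> simp

/-- If a derivation `D`, corrected by row operations with coefficients `a`, agrees on the
variables with the polarization of columns, then so it does on the products of minors, where
the row operations act by scalars. -/
lemma specialize_colPolarization_of_mem_minorProducts {n : ℕ} (k : ℕ → ℕ) {i j : ℕ}
    (hi : i ∈ Finset.Icc 1 (n + 1)) (hj : j ∈ Finset.Icc 1 (n + 1))
    (D : Derivation ℂ Rpoly Rpoly) (a : ℕ → ℕ → Rpoly)
    (h : ∀ s ∈ Finset.Icc 1 n, ∀ t ∈ Finset.Icc 1 (n + 1),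
      (if t = j then Xv s i else 0) = D (Xv s t) + ∑ r ∈ Finset.Icc s n, a r s * Xv r t) :
    ∀ f ∈ minorProducts n k, specialize n (colPolarization n i j f) =
      D (specialize n f) +
        (∑ s ∈ Finset.range (n + 1), C (rowDegree n k s) * a s s) * specialize n f := by
  have key : ∀ f, specialize n (colPolarization n i j f) = D (specialize n f) +
      ∑ s ∈ Finset.Icc 1 n, ∑ r ∈ Finset.Icc s n,
        a r s * specialize n (rowPolarization n r s f) := by
    intro f
    induction f using MvPolynomial.induction_on with
    | C c => simp [specialize]
    | add f g hf hg =>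
      simp only [map_add, mul_add, Finset.sum_add_distrib, hf, hg]
      abel
    | mul_X f p hf =>
      have hX : specialize n (colPolarization n i j (X p)) = D (specialize n (X p)) +
          ∑ s ∈ Finset.Icc 1 n, ∑ r ∈ Finset.Icc s n,
            a r s * specialize n (rowPolarization n r s (X p)) := by
        obtain ⟨s, t⟩ := p
        by_cases hp : (s, t) ∈ genericBox n
        · obtain ⟨hs, ht⟩ : s ∈ Finset.Icc 1 n ∧ t ∈ Finset.Icc 1 (n + 1) :=
            Finset.mem_product.mp hp
          rw [colPolarization_X hs, specialize_X hs ht, apply_ite (specialize n),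
            specialize_X hs hi, map_zero, h s hs t ht]
          congr 1
          symm
          rw [Finset.sum_eq_single s]
          · refine Finset.sum_congr rfl fun r hr => ?_
            rw [Finset.mem_Icc] at hr hs
            rw [rowPolarization_X ht, if_pos rfl,
              specialize_X (Finset.mem_Icc.mpr ⟨by omega, hr.2⟩) ht]
          · intro s' _ hs'
            refine Finset.sum_eq_zero fun r _ => ?_
            rw [rowPolarization_X ht, if_neg (Ne.symm hs'), map_zero, mul_zero]
          · exact fun hs' => absurd hs hs'
        · have hcol : colPolarization n i j (X (s, t)) = 0 := by
            rw [colPolarization_apply]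
            refine Finset.sum_eq_zero fun r hr => ?_
            rw [pderiv_X_of_ne, mul_zero]
            intro heq
            rw [Prod.mk.injEq] at heq
            exact hp (Finset.mem_product.mpr ⟨heq.1 ▸ hr, heq.2 ▸ hj⟩)
          have hrow : ∀ s' ∈ Finset.Icc 1 n, ∀ r, rowPolarization n r s' (X (s, t)) = 0 := by
            intro s' hs' r
            rw [rowPolarization, derivation_sum_apply]
            refine Finset.sum_eq_zero fun t' ht' => ?_
            rw [Derivation.smul_apply, pderiv_X_of_ne, smul_zero]
            intro heq
            rw [Prod.mk.injEq] at heq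
            exact hp (Finset.mem_product.mpr ⟨heq.1 ▸ hs', heq.2 ▸ ht'⟩)
          rw [hcol, specialize_X_of_notMem hp, map_zero, map_zero, zero_add]
          symm
          refine Finset.sum_eq_zero fun s' hs' => Finset.sum_eq_zero fun r _ => ?_
          rw [hrow s' hs', map_zero, mul_zero]
      simp only [Derivation.leibniz, smul_eq_mul, map_add, map_mul, mul_add,
        Finset.sum_add_distrib, hf, hX, ← Finset.mul_sum, mul_left_comm (a _ _)]
      ring
  intro f hf
  have hzero : ∑ s ∈ Finset.Icc 1 n, C (rowDegree n k s) * a s s =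
      ∑ s ∈ Finset.range (n + 1), C (rowDegree n k s) * a s s := by
    refine Finset.sum_subset (fun s hs => ?_) fun s hs hs' => ?_
    · rw [Finset.mem_Icc] at hs
      exact Finset.mem_range.mpr (by omega)
    · rw [Finset.mem_range] at hs
      rw [Finset.mem_Icc] at hs'
      obtain rfl : s = 0 := by omega
      simp [rowDegree]
  rw [key, ← hzero, Finset.sum_mul]
  congr 1
  refine Finset.sum_congr rfl fun s hs => ?_
  rw [Finset.mem_Icc] at hs
  rw [Finset.sum_eq_single s]
  · rw [rowPolarization_eq_of_mem_minorProducts k le_rfl (by omega) f hf, if_pos rfl, map_smul,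
      Algebra.smul_def, algebraMap_eq]
    ring
  · intro r hr hrs
    rw [Finset.mem_Icc] at hr
    rw [rowPolarization_eq_of_mem_minorProducts k hr.1 hr.2 f hf, if_neg hrs, zero_smul, map_zero,
      mul_zero]
  · intro hs'
    exact absurd (Finset.mem_Icc.mpr ⟨le_rfl, by omega⟩) hs'

/-! ### The expansion of `DPoly` -/

lemma DPoly_eq_minor {m s d : ℕ} (h : m = s + d) (t : ℕ) :
    DPoly m s t = minor Xv s (d + 1) fun b => if b.1 = 0 then t else s + b.1 := by
  obtain rfl : d = m - s := by omega
  rfl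

lemma DPoly_self (m t : ℕ) : DPoly m m t = Xv m t := by
  rw [DPoly_eq_minor (d := 0) (by omega), minor, Matrix.det_fin_one]
  rfl

lemma DPoly_rec {m s : ℕ} (h : s < m) (t : ℕ) :
    DPoly m s t = Xv s t * DPoly m (s + 1) (s + 1) + DPoly m (s + 1) t := by
  obtain ⟨d, rfl⟩ : ∃ d, m = s + 1 + d := ⟨m - (s + 1), by omega⟩
  rw [DPoly_eq_minor (d := d + 1) (by omega), DPoly_eq_minor rfl, DPoly_eq_minor rfl, minor,
    Matrix.det_succ_row_zero, Fin.sum_univ_succ, Fin.sum_univ_succ, Finset.sum_eq_zero, add_zero]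
  · congr 1
    · simp only [Fin.val_zero, pow_zero, one_mul, Matrix.of_apply, if_true, add_zero]
      congr 1
      rw [minor]
      congr 1
      ext1 a b
      simp only [Matrix.submatrix_apply, Matrix.of_apply, Fin.succAbove_zero, Fin.val_succ]
      rw [show s + 1 + a.1 = s + (a.1 + 1) by omega]
      congr 1
      rw [if_neg (by omega)]
      split_ifs <;> omega
    · have : Xv s (s + 1) = -1 := Xv_succ s
      simp only [Matrix.of_apply, Fin.val_succ, Fin.val_zero, zero_add, add_zero, pow_one,
        one_ne_zero, if_false, this, neg_mul_neg, one_mul]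
      rw [minor]
      congr 1
      ext1 a b
      simp only [Matrix.submatrix_apply, Matrix.of_apply, Fin.val_succ]
      rw [show s + 1 + a.1 = s + (a.1 + 1) by omega]
      congr 1
      refine Fin.cases ?_ (fun b => ?_) b
      · simp
      · simp
        omega
  · intro b _
    simp only [Matrix.of_apply, Fin.val_succ, Fin.val_zero, add_zero]
    rw [if_neg (by omega), Xv_eq_zero (by omega)]
    simp

/-- The coefficient of `Xv r t` in the expansion of `DPoly m s t`. -/
def DCoeff (m r : ℕ) : Rpoly := if r = m then 1 else DPoly m (r + 1) (r + 1)

lemma DPoly_eq_sum {m s : ℕ} (h : s ≤ m) (t : ℕ) :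
    DPoly m s t = ∑ r ∈ Finset.Icc s m, Xv r t * DCoeff m r := by
  induction h using Nat.decreasingInduction with
  | self => simp [DPoly_self, DCoeff]
  | of_succ s hs ih =>
    rw [DPoly_rec hs, ih, ← Finset.add_sum_Ioc_eq_sum_Icc hs.le, DCoeff, if_neg hs.ne,
      Finset.Icc_add_one_left_eq_Ioc]

lemma DPoly_of_lt {m s t : ℕ} (h : s ≤ m) (hst : s < t) :
    DPoly m s t = if t = m + 1 then -1 else 0 := by
  induction h using Nat.decreasingInduction with
  | self => rw [DPoly_self, Xv, if_neg (by omega)]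
  | of_succ s hs ih =>
    rw [DPoly_rec hs]
    rcases eq_or_lt_of_le (Nat.succ_le_of_lt hst) with h | h
    · subst h
      rw [Xv_succ, if_neg (by omega)]
      ring
    · rw [Xv_eq_zero (by omega), ih (by omega), zero_mul, zero_add]

lemma rowDegree_sub {n : ℕ} (k : ℕ → ℕ) {i r : ℕ} (hi : 1 ≤ i) (hir : i ≤ r) (hr : r ≤ n) :
    rowDegree n k r = rowDegree n k (i - 1) + ∑ s ∈ Finset.Icc i r, (k (n + 1 - s) : ℂ) := by
  obtain ⟨i, rfl⟩ : ∃ i', i = i' + 1 := ⟨i - 1, by omega⟩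
  rw [Nat.add_sub_cancel]
  induction r, hir using Nat.le_induction with
  | base =>
    rw [rowDegree, Finset.sum_Icc_succ_top (by omega), Finset.Icc_self, Finset.sum_singleton,
      rowDegree, show n - (i + 1) + 1 = n + 1 - (i + 1) by omega]
  | succ r h ih =>
    rw [rowDegree, Finset.sum_Icc_succ_top (by omega), Finset.sum_Icc_succ_top (by omega),
      ← add_assoc, ← ih (by omega), rowDegree, show n - (r + 1) + 1 = n + 1 - (r + 1) by omega]

lemma sum_rowDegree_mul {n m i : ℕ} (k : ℕ → ℕ) (hi : 1 ≤ i) (him : i ≤ m) (hm : m ≤ n) :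
    ∑ s ∈ Finset.Icc (i - 1) m, C (rowDegree n k s) * (Xv s i * DCoeff m s) =
      ∑ s ∈ Finset.Icc i m, (k (n + 1 - s) : ℂ) • DPoly m s i := by
  have hfirst : DCoeff m (i - 1) = ∑ r ∈ Finset.Icc i m, Xv r i * DCoeff m r := by
    rw [← DPoly_eq_sum him, DCoeff, if_neg (by omega), Nat.sub_add_cancel hi]
  have hX : Xv (i - 1) i = -1 := by
    conv_lhs => rw [← Nat.sub_add_cancel hi, Nat.add_sub_cancel]
    exact Xv_succ _
  have hR : ∑ s ∈ Finset.Icc i m, (k (n + 1 - s) : ℂ) • DPoly m s i =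
      ∑ r ∈ Finset.Icc i m, (∑ s ∈ Finset.Icc i r, (k (n + 1 - s) : ℂ)) •
        (Xv r i * DCoeff m r) := by
    simp_rw [Finset.sum_smul]
    rw [Finset.sum_congr rfl fun s hs => by
      rw [DPoly_eq_sum (Finset.mem_Icc.mp hs).2, Finset.smul_sum]]
    refine Finset.sum_comm' fun s r => ?_
    simp only [Finset.mem_Icc]
    omega
  rw [hR, ← Finset.add_sum_Ioc_eq_sum_Icc (by omega), hX, hfirst,
    ← Finset.Icc_add_one_left_eq_Ioc, Nat.sub_add_cancel hi, neg_one_mul, mul_neg, Finset.mul_sum,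
    ← Finset.sum_neg_distrib, ← Finset.sum_add_distrib]
  refine Finset.sum_congr rfl fun r hr => ?_
  rw [Finset.mem_Icc] at hr
  rw [rowDegree_sub k hi hr.1 (hr.2.trans hm), C_add, Algebra.smul_def, algebraMap_eq]
  ring

/-! ### Equivariance of the specialization -/

lemma sum_smul_pderiv_Xv {S : Finset ℕ} (g : ℕ → Rpoly) (j s t : ℕ) :
    (∑ r ∈ S, g r • pderiv (r, j) : Derivation ℂ Rpoly Rpoly) (Xv s t) =
      if s ∈ S ∧ t = j ∧ t ≤ s then g s else 0 := by
  rw [derivation_sum_apply]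
  simp only [Derivation.smul_apply, pderiv_Xv, smul_eq_mul, mul_ite, mul_one, mul_zero,
    Prod.mk.injEq]
  split_ifs with h
  · rw [Finset.sum_eq_single s]
    · rw [if_pos ⟨⟨rfl, h.2.1.symm⟩, h.2.2⟩]
    · intro r _ hr
      rw [if_neg fun h' => hr h'.1.1]
    · exact fun h' => absurd h.1 h'
  · refine Finset.sum_eq_zero fun r hr => ?_
    rw [if_neg]
    rintro ⟨⟨rfl, rfl⟩, h'⟩
    exact h ⟨hr, rfl, h'⟩

lemma specialize_colPolarization_diag {n : ℕ} (c : ℂ) (k : ℕ → ℕ) {i : ℕ}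
    (hi : i ∈ Finset.Icc 1 (n + 1)) : ∃ μ : ℂ, ∀ f ∈ minorProducts n k,
      specialize n (colPolarization n i i f) = ρ n c k i i (specialize n f) +
        μ • specialize n f := by
  classical
  let D : Derivation ℂ Rpoly Rpoly := ∑ r ∈ Finset.Icc i n, Xv r i • pderiv (r, i) -
    ∑ s ∈ Finset.Icc 1 (i - 1), Xv (i - 1) s • pderiv (i - 1, s)
  have h := specialize_colPolarization_of_mem_minorProducts k hi hi D
    (fun r s => if r = i - 1 ∧ s = i - 1 then 1 else 0) ?_
  · refine ⟨rowDegree n k (i - 1) - (c - ∑ r ∈ Finset.Icc i n, (k (n - r + 1) : ℂ)),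
      fun f hf => ?_⟩
    rw [h f hf, Finset.sum_eq_single (i - 1)]
    · rw [ρ, if_pos rfl]
      simp only [D, mulOp, pd, derivation_sum_apply, Derivation.sub_apply, Derivation.smul_apply,
        LinearMap.add_apply, LinearMap.sub_apply, LinearMap.smul_apply, LinearMap.sum_apply,
        LinearMap.comp_apply, LinearMap.mulLeft_apply, Module.End.one_apply, sub_smul,
        smul_eq_mul, Derivation.coeFn_coe, and_self, if_true,
        mul_one, MvPolynomial.smul_eq_C_mul]
      ring
    · intro s _ hs
      rw [if_neg fun h' => hs h'.1, mul_zero]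
    · intro h'
      rw [Finset.mem_Icc] at hi
      exact absurd (Finset.mem_range.mpr (by omega)) h'
  · intro s hs t ht
    rw [Finset.mem_Icc] at hs ht hi
    have hrow : (∑ s' ∈ Finset.Icc 1 (i - 1), Xv (i - 1) s' • pderiv (i - 1, s') :
        Derivation ℂ Rpoly Rpoly) (Xv s t) = if s = i - 1 ∧ t ≤ s then Xv s t else 0 := by
      rw [derivation_sum_apply]
      simp only [Derivation.smul_apply, pderiv_Xv, smul_eq_mul, mul_ite, mul_one, mul_zero,
        Prod.mk.injEq]
      split_ifs with h
      · rw [Finset.sum_eq_single t]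
        · rw [if_pos ⟨⟨h.1.symm, rfl⟩, h.2⟩, h.1]
        · intro r _ hr
          rw [if_neg fun h' => hr h'.1.2]
        · intro h'
          exact absurd (Finset.mem_Icc.mpr ⟨by omega, by omega⟩) h'
      · refine Finset.sum_eq_zero fun r hr => ?_
        rw [if_neg]
        rintro ⟨⟨rfl, rfl⟩, h'⟩
        exact h ⟨rfl, h'⟩
    have hgauge : ∑ r ∈ Finset.Icc s n,
        (if r = i - 1 ∧ s = i - 1 then (1 : Rpoly) else 0) * Xv r t =
          if s = i - 1 then Xv s t else 0 := by
      split_ifs with h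
      · rw [Finset.sum_eq_single s]
        · simp [h]
        · intro r _ hr
          rw [if_neg (by omega), zero_mul]
        · intro h'
          exact absurd (Finset.mem_Icc.mpr ⟨le_rfl, hs.2⟩) h'
      · simp [h]
    rw [hgauge, Derivation.sub_apply, sum_smul_pderiv_Xv, hrow]
    simp only [Finset.mem_Icc]
    by_cases hts : t ≤ s
    · have hmem : t = i → i ≤ s ∧ s ≤ n := by omega
      by_cases h1 : t = i
      · rw [if_pos h1, if_pos ⟨hmem h1, h1, hts⟩, if_neg (by omega), if_neg (by omega)]
        ring
      · rw [if_neg h1, if_neg fun h' => h1 h'.2.1]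
        simp [hts]
    · rw [if_neg (show ¬((i ≤ s ∧ s ≤ n) ∧ t = i ∧ t ≤ s) by omega),
        if_neg (show ¬(s = i - 1 ∧ t ≤ s) by omega)]
      by_cases h1 : t = i
      · subst h1
        rw [if_pos rfl]
        split_ifs with h2
        · ring
        · rw [Xv_eq_zero (by omega)]
          ring
      · rw [if_neg h1]
        split_ifs with h2
        · rw [Xv_eq_zero (by omega)]
          ring
        · ring

lemma specialize_colPolarization_lower {n : ℕ} (c : ℂ) (k : ℕ → ℕ) {i j : ℕ}
    (hi : i ∈ Finset.Icc 1 (n + 1)) (hj : j ∈ Finset.Icc 1 (n + 1)) (hij : j < i) :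
    ∀ f ∈ minorProducts n k,
      specialize n (colPolarization n i j f) = ρ n c k i j (specialize n f) := by
  let D : Derivation ℂ Rpoly Rpoly :=
    -pderiv (i - 1, j) + ∑ r ∈ Finset.Icc i n, Xv r i • pderiv (r, j)
  have h := specialize_colPolarization_of_mem_minorProducts k hi hj D (fun _ _ => 0) ?_
  · intro f hf
    rw [h f hf, ρ, if_neg hij.ne', if_pos hij]
    simp [D, mulOp, pd, derivation_sum_apply]
  · intro s hs t ht
    rw [Finset.mem_Icc] at hs ht hi hj
    simp only [zero_mul, Finset.sum_const_zero, add_zero]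
    rw [Derivation.add_apply, Derivation.neg_apply, sum_smul_pderiv_Xv, pderiv_Xv]
    simp only [Finset.mem_Icc, Prod.mk.injEq]
    by_cases h1 : t = j
    · subst h1
      rw [if_pos rfl]
      rcases lt_trichotomy s (i - 1) with h2 | h2 | h2
      · rw [Xv_eq_zero (by omega), if_neg (by omega), if_neg (by omega)]
        ring
      · obtain rfl : i = s + 1 := by omega
        rw [Xv_succ, if_pos (by omega), if_neg (by omega)]
        ring
      · rw [if_neg (by omega), if_pos (by omega)]
        ring
    · rw [if_neg h1, if_neg (by omega), if_neg (by omega)]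
      ring

lemma specialize_colPolarization_upper {n : ℕ} (c : ℂ) (k : ℕ → ℕ) {i j : ℕ}
    (hi : i ∈ Finset.Icc 1 (n + 1)) (hj : j ∈ Finset.Icc 1 (n + 1)) (hij : i < j) :
    ∀ f ∈ minorProducts n k,
      specialize n (colPolarization n i j f) = ρ n c k i j (specialize n f) := by
  let D : Derivation ℂ Rpoly Rpoly := ∑ r ∈ Finset.Icc j n, Xv r i • pderiv (r, j) +
    ∑ s ∈ Finset.Icc (i - 1) (j - 1), ∑ t ∈ Finset.Icc 1 s,
      (DPoly (j - 1) s t * Xv s i) • pderiv (s, t)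
  have h := specialize_colPolarization_of_mem_minorProducts k hi hj D
    (fun r s => if i - 1 ≤ s ∧ r ≤ j - 1 then -(Xv s i * DCoeff (j - 1) r) else 0) ?_
  all_goals rw [Finset.mem_Icc] at hi hj
  · intro f hf
    have hscalar : ∑ s ∈ Finset.range (n + 1), C (rowDegree n k s) *
        (if i - 1 ≤ s ∧ s ≤ j - 1 then -(Xv s i * DCoeff (j - 1) s) else 0) =
          -∑ s ∈ Finset.Icc i (j - 1), (k (n + 1 - s) : ℂ) • DPoly (j - 1) s i := by
      rw [← sum_rowDegree_mul k hi.1 (by omega) (by omega), ← Finset.sum_neg_distrib]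
      symm
      refine Finset.sum_subset_zero_on_sdiff ?_ ?_ ?_
      · intro s hs
        rw [Finset.mem_Icc] at hs
        exact Finset.mem_range.mpr (by omega)
      · intro s hs
        rw [Finset.mem_sdiff, Finset.mem_Icc] at hs
        rw [if_neg hs.2, mul_zero]
      · intro s hs
        rw [Finset.mem_Icc] at hs
        rw [if_pos hs, mul_neg]
    rw [h f hf, hscalar, ρ, if_neg hij.ne, if_neg (by omega)]
    simp [D, mulOp, pd, derivation_sum_apply, sub_eq_add_neg, mul_assoc]
  · intro s hs t ht
    rw [Finset.mem_Icc] at hs ht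
    have hrow : (∑ s ∈ Finset.Icc (i - 1) (j - 1), ∑ t ∈ Finset.Icc 1 s,
        (DPoly (j - 1) s t * Xv s i) • pderiv (s, t) : Derivation ℂ Rpoly Rpoly) (Xv s t) =
          if i - 1 ≤ s ∧ s ≤ j - 1 ∧ t ≤ s then DPoly (j - 1) s t * Xv s i else 0 := by
      rw [derivation_sum_apply]
      simp only [derivation_sum_apply, Derivation.smul_apply, pderiv_Xv, smul_eq_mul, mul_ite,
        mul_one, mul_zero, Prod.mk.injEq]
      split_ifs with h
      · rw [Finset.sum_eq_single s, Finset.sum_eq_single t]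
        · rw [if_pos ⟨⟨rfl, rfl⟩, h.2.2⟩]
        · intro t' _ h'
          rw [if_neg fun h'' => h' h''.1.2]
        · intro h'
          exact absurd (Finset.mem_Icc.mpr ⟨ht.1, h.2.2⟩) h'
        · intro s' _ h'
          exact Finset.sum_eq_zero fun t' _ => if_neg fun h'' => h' h''.1.1
        · intro h'
          exact absurd (Finset.mem_Icc.mpr ⟨h.1, h.2.1⟩) h'
      · refine Finset.sum_eq_zero fun s' hs' => Finset.sum_eq_zero fun t' ht' => ?_
        rw [Finset.mem_Icc] at hs' ht'
        rw [if_neg]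
        rintro ⟨⟨rfl, rfl⟩, h'⟩
        exact h ⟨hs'.1, hs'.2, h'⟩
    have hgauge : ∑ r ∈ Finset.Icc s n,
        (if i - 1 ≤ s ∧ r ≤ j - 1 then -(Xv s i * DCoeff (j - 1) r) else 0) * Xv r t =
          if i - 1 ≤ s ∧ s ≤ j - 1 then -(Xv s i * DPoly (j - 1) s t) else 0 := by
      split_ifs with h
      · rw [DPoly_eq_sum h.2, Finset.mul_sum, ← Finset.sum_neg_distrib]
        symm
        refine Finset.sum_subset_zero_on_sdiff (Finset.Icc_subset_Icc le_rfl (by omega)) ?_ ?_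
        · intro r hr
          simp only [Finset.mem_sdiff, Finset.mem_Icc] at hr
          rw [if_neg (by omega), zero_mul]
        · intro r hr
          rw [Finset.mem_Icc] at hr
          rw [if_pos ⟨h.1, hr.2⟩]
          ring
      · refine Finset.sum_eq_zero fun r hr => ?_
        rw [Finset.mem_Icc] at hr
        rw [if_neg (by omega), zero_mul]
    rw [hgauge, Derivation.add_apply, sum_smul_pderiv_Xv, hrow]
    simp only [Finset.mem_Icc]
    by_cases hmid : i - 1 ≤ s ∧ s ≤ j - 1
    · rw [if_pos hmid, if_neg (show ¬((j ≤ s ∧ s ≤ n) ∧ t = j ∧ t ≤ s) by omega), zero_add]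
      by_cases hts : t ≤ s
      · rw [if_neg (show t ≠ j by omega), if_pos ⟨hmid.1, hmid.2, hts⟩]
        ring
      · rw [if_neg (show ¬(i - 1 ≤ s ∧ s ≤ j - 1 ∧ t ≤ s) by omega),
          DPoly_of_lt hmid.2 (by omega), Nat.sub_add_cancel hj.1]
        split_ifs <;> ring
    · rw [if_neg hmid, if_neg (show ¬(i - 1 ≤ s ∧ s ≤ j - 1 ∧ t ≤ s) by omega), add_zero, add_zero]
      by_cases h1 : t = j
      · rw [if_pos h1]
        rcases lt_or_ge s (i - 1) with h2 | h2
        · rw [if_neg (by omega), Xv_eq_zero (by omega)]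
        · rw [if_pos (by omega)]
      · rw [if_neg h1, if_neg (by omega)]

lemma specialize_colPolarization {n : ℕ} (c : ℂ) (k : ℕ → ℕ) {i j : ℕ}
    (hi : i ∈ Finset.Icc 1 (n + 1)) (hj : j ∈ Finset.Icc 1 (n + 1)) :
    ∃ μ : ℂ, ∀ f ∈ minorProducts n k,
      specialize n (colPolarization n i j f) = ρ n c k i j (specialize n f) +
        μ • specialize n f := by
  rcases lt_trichotomy i j with h | rfl | h
  · exact ⟨0, fun f hf => by
      rw [specialize_colPolarization_upper c k hi hj h f hf, zero_smul, add_zero]⟩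
  · exact specialize_colPolarization_diag c k hi
  · exact ⟨0, fun f hf => by
      rw [specialize_colPolarization_lower c k hi hj h f hf, zero_smul, add_zero]⟩

/-! ### The span of the products of minors after specialization -/

lemma minor_Xv_snoc {j s : ℕ} (Θ : Fin s → ℕ) :
    minor Xv j (s + 1) (Fin.snoc Θ (j + s + 1) : Fin (s + 1) → ℕ) = -minor Xv j s Θ := by
  rw [minor, Matrix.det_succ_column _ (Fin.last s), Fin.sum_univ_castSucc, Finset.sum_eq_zero,
    zero_add]
  · simp only [Matrix.of_apply, Fin.snoc_last, Fin.val_last]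
    rw [Xv_succ, ← two_mul, pow_mul, neg_one_sq, one_pow, one_mul, neg_one_mul, minor]
    congr 2
    ext1 a b
    simp [Fin.succAbove_last]
  · intro a _
    have := a.2
    simp only [Matrix.of_apply, Fin.snoc_last, Fin.val_castSucc]
    rw [Xv_eq_zero (by omega), mul_zero, zero_mul]

/-- The span of the minors with rows `j, ..., n` of the specialized matrix. -/
def specializedSpan (n j : ℕ) : Submodule ℂ Rpoly :=
  (minorSpan n j).map (specialize n).toLinearMap

lemma minor_mem_specializedSpan {n j s : ℕ} (hj : 1 ≤ j) (hjn : j ≤ n) (hs : s ≤ n - j + 1)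
    {Θ : Fin s → ℕ} (hΘ : ∀ b, Θ b ∈ Finset.Icc 1 (n + 1)) :
    minor Xv j s Θ ∈ specializedSpan n j := by
  induction hs using Nat.decreasingInduction with
  | self =>
    rw [← specialize_minor hj (by omega) hΘ]
    exact Submodule.mem_map_of_mem (Submodule.subset_span ⟨Θ, hΘ, rfl⟩)
  | of_succ s hs ih =>
    rw [← neg_neg (minor Xv j s Θ), ← minor_Xv_snoc]
    refine neg_mem (ih fun b => ?_)
    refine Fin.lastCases ?_ (fun b => ?_) b
    · rw [Fin.snoc_last, Finset.mem_Icc]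
      omega
    · rw [Fin.snoc_castSucc]
      exact hΘ b

lemma one_le_specializedSpan {n j : ℕ} (hj : 1 ≤ j) (hjn : j ≤ n) :
    1 ≤ specializedSpan n j := by
  rw [Submodule.one_le]
  have h := minor_mem_specializedSpan (s := 0) hj hjn (by omega) (Θ := Fin.elim0)
    fun b => b.elim0
  rwa [minor, Matrix.det_isEmpty] at h

lemma map_minorProducts (n : ℕ) (k : ℕ → ℕ) :
    (minorProducts n k).map (specialize n).toLinearMap =
      ∏ j ∈ Finset.Icc 1 n, specializedSpan n j ^ k (n - j + 1) := by
  have h := map_prod (Submodule.mapHom (specialize n))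
    (fun j => minorSpan n j ^ k (n - j + 1)) (Finset.Icc 1 n)
  simp only [map_pow] at h
  exact h

lemma prod_mem_pow_sum {ι : Type*} {B : Submodule ℂ Rpoly} (S : Finset ι) (f : ι → Rpoly)
    (e : ι → ℕ) (h : ∀ x ∈ S, f x ∈ B ^ e x) : ∏ x ∈ S, f x ∈ B ^ ∑ x ∈ S, e x := by
  classical
  induction S using Finset.induction_on with
  | empty =>
    rw [Finset.prod_empty, Finset.sum_empty, pow_zero]
    exact Submodule.one_le.mp le_rfl
  | insert x S hx ih =>
    rw [Finset.prod_insert hx, Finset.sum_insert hx, pow_add]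
    exact Submodule.mul_mem_mul (h x (Finset.mem_insert_self _ _))
      (ih fun y hy => h y (Finset.mem_insert_of_mem hy))

lemma prod_mem_prod_submodule {ι : Type*} (S : Finset ι) (f : ι → Rpoly)
    (B : ι → Submodule ℂ Rpoly) (h : ∀ x ∈ S, f x ∈ B x) : ∏ x ∈ S, f x ∈ ∏ x ∈ S, B x := by
  classical
  induction S using Finset.induction_on with
  | empty =>
    rw [Finset.prod_empty, Finset.prod_empty]
    exact Submodule.one_le.mp le_rfl
  | insert x S hx ih =>
    rw [Finset.prod_insert hx, Finset.prod_insert hx]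
    exact Submodule.mul_mem_mul (h x (Finset.mem_insert_self _ _))
      (ih fun y hy => h y (Finset.mem_insert_of_mem hy))

lemma Sset_subset_map_minorProducts (n : ℕ) (k : ℕ → ℕ) :
    Sset n k ⊆ (minorProducts n k).map (specialize n).toLinearMap := by
  rintro f ⟨α, -, hα, rfl⟩
  rw [map_minorProducts, SetLike.mem_coe, Finset.prod_comm' (t' := Finset.Icc 1 n)
    (s' := fun j => Finset.Icc j n) (h := fun i j => by simp only [Finset.mem_Icc]; omega)]
  refine prod_mem_prod_submodule _ _ _ fun j hj => ?_
  obtain ⟨hj1, hjn⟩ := Finset.mem_Icc.mp hj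
  refine pow_le_pow_right₀ (one_le_specializedSpan hj1 hjn) (hα j hj) ?_
  refine prod_mem_pow_sum _ _ _ fun i hi => prod_mem_pow_sum _ _ _ fun Θ hΘ => ?_
  rw [Finset.mem_Icc] at hi
  refine Submodule.pow_mem_pow _ (minor_mem_specializedSpan hj1 hjn (by omega) fun b => ?_) _
  have := Finset.mem_Icc.mp (Fintype.mem_piFinset.mp hΘ b)
  rw [Finset.mem_Icc]
  omega

lemma one_mem_Sset0 (n : ℕ) (k : ℕ → ℕ) : 1 ∈ Sset0 n k :=
  ⟨fun _ _ _ => 0, fun _ _ _ _ => rfl, fun _ _ => rfl, by simp, by simp⟩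

lemma Sset0_subset_Sset (n : ℕ) (k : ℕ → ℕ) : Sset0 n k ⊆ Sset n k := by
  rintro f ⟨α, h1, -, h2, h3⟩
  exact ⟨α, h1, h2, h3⟩

lemma Sset_mono {n : ℕ} {k k' : ℕ → ℕ}
    (h : ∀ j ∈ Finset.Icc 1 n, k (n - j + 1) ≤ k' (n - j + 1)) : Sset n k ⊆ Sset n k' := by
  rintro f ⟨α, h1, h2, h3⟩
  exact ⟨α, h1, fun j hj => (h2 j hj).trans (h j hj), h3⟩

lemma mul_mem_Sset {n : ℕ} {k k' : ℕ → ℕ} {f g : Rpoly} (hf : f ∈ Sset n k)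
    (hg : g ∈ Sset n k') : f * g ∈ Sset n (k + k') := by
  obtain ⟨α, hα1, hα2, rfl⟩ := hf
  obtain ⟨β, hβ1, hβ2, rfl⟩ := hg
  refine ⟨fun i j Θ => α i j Θ + β i j Θ, fun i j Θ h => ?_, fun j hj => ?_, ?_⟩
  · change α i j Θ + β i j Θ = 0
    rw [hα1 i j Θ h, hβ1 i j Θ h]
  · simp only [Finset.sum_add_distrib]
    exact add_le_add (hα2 j hj) (hβ2 j hj)
  · simp only [pow_add, Finset.prod_mul_distrib]

lemma dPoly_mem_Sset {n i j : ℕ} (hj : 1 ≤ j) (hji : j ≤ i) (hin : i ≤ n)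
    {Θ : Fin (i - j + 1) → ℕ} (hΘ : Θ ∈ tuples n i j) (h0 : dPoly i j Θ ≠ 0) :
    dPoly i j Θ ∈ Sset n (Pi.single (n - j + 1) 1) := by
  classical
  obtain ⟨α, hα, hα'⟩ : ∃ α : (i j : ℕ) → (Fin (i - j + 1) → ℕ) → ℕ, α i j Θ = 1 ∧
      ∀ i' j' Θ', α i' j' Θ' ≠ 0 → i' = i ∧ j' = j ∧ HEq Θ' Θ := by
    refine ⟨fun i' j' Θ' => if i' = i ∧ j' = j ∧ HEq Θ' Θ then 1 else 0,
      if_pos ⟨rfl, rfl, HEq.rfl⟩, fun i' j' Θ' h => ?_⟩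
    by_contra h'
    exact h (if_neg h')
  have hi : ∀ {i' j' Θ'}, i' ≠ i → α i' j' Θ' = 0 := fun h => by
    by_contra h'
    exact h (hα' _ _ _ h').1
  have hj' : ∀ {i' j' Θ'}, j' ≠ j → α i' j' Θ' = 0 := fun h => by
    by_contra h'
    exact h (hα' _ _ _ h').2.1
  have hΘ' : ∀ {Θ'}, Θ' ≠ Θ → α i j Θ' = 0 := fun h => by
    by_contra h'
    exact h (eq_of_heq (hα' _ _ _ h').2.2)
  refine ⟨α, fun i' j' Θ' h => ?_, fun j' _ => ?_, ?_⟩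
  · by_contra h'
    obtain ⟨rfl, rfl, h''⟩ := hα' _ _ _ h'
    exact h0 (eq_of_heq h'' ▸ h)
  · by_cases hjj : j' = j
    · subst hjj
      rw [Finset.sum_eq_single i, Finset.sum_eq_single Θ, hα, Pi.single_eq_same]
      · exact fun Θ' _ h => hΘ' h
      · exact fun h => absurd hΘ h
      · exact fun i' _ h => Finset.sum_eq_zero fun Θ' _ => hi h
      · exact fun h => absurd (Finset.mem_Icc.mpr ⟨hji, hin⟩) h
    · rw [Finset.sum_eq_zero fun i' _ => Finset.sum_eq_zero fun Θ' _ => hj' hjj]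
      exact Nat.zero_le _
  · rw [Finset.prod_eq_single i, Finset.prod_eq_single j, Finset.prod_eq_single Θ, hα, pow_one]
    · intro Θ' _ h
      rw [hΘ' h, pow_zero]
    · exact fun h => absurd hΘ h
    · refine fun j' _ h => Finset.prod_eq_one fun Θ' _ => ?_
      rw [hj' h, pow_zero]
    · exact fun h => absurd (Finset.mem_Icc.mpr ⟨hj, hji⟩) h
    · refine fun i' _ h => Finset.prod_eq_one fun j' _ => Finset.prod_eq_one fun Θ' _ => ?_
      rw [hi h, pow_zero]
    · exact fun h => absurd (Finset.mem_Icc.mpr ⟨hj.trans hji, hin⟩) h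

lemma minor_mem_span_Sset {n j s : ℕ} (hj : 1 ≤ j) (hs : j + s ≤ n + 1) {Θ : Fin s → ℕ}
    (hΘ : ∀ b, Θ b ∈ Finset.Icc 1 n) :
    minor Xv j s Θ ∈ Submodule.span ℂ (Sset n (Pi.single (n - j + 1) 1)) := by
  rcases s with _ | s
  · rw [minor, Matrix.det_isEmpty]
    exact Submodule.subset_span (Sset0_subset_Sset _ _ (one_mem_Sset0 _ _))
  · obtain ⟨i, hi⟩ : ∃ i, i = j + s := ⟨_, rfl⟩
    obtain rfl : s = i - j := by omega
    by_cases h0 : dPoly i j Θ = 0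
    · have h : minor Xv j (i - j + 1) Θ = 0 := h0
      rw [h]
      exact zero_mem _
    · exact Submodule.subset_span (dPoly_mem_Sset hj (by omega) (by omega)
        (Fintype.mem_piFinset.mpr hΘ) h0)

lemma specializedSpan_le {n j : ℕ} (hj : j ∈ Finset.Icc 1 n) :
    specializedSpan n j ≤ Submodule.span ℂ (Sset n (Pi.single (n - j + 1) 1)) := by
  rw [Finset.mem_Icc] at hj
  rw [specializedSpan, minorSpan, Submodule.map_span_le]
  rintro f ⟨Θ, hΘ, rfl⟩
  rw [AlgHom.toLinearMap_apply, specialize_minor hj.1 (by omega) hΘ]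
  by_cases hinj : Function.Injective Θ
  · by_cases hlast : ∃ b, Θ b = n + 1
    · obtain ⟨b, hb⟩ := hlast
      let σ := Equiv.swap b (Fin.last (n - j))
      have hσ : (Θ ∘ σ) ∘ σ = Θ := by
        ext
        simp [σ]
      have hsnoc : Θ ∘ σ =
          Fin.snoc (fun b : Fin (n - j) => Θ (σ b.castSucc)) (j + (n - j) + 1) := by
        ext b'
        refine Fin.lastCases ?_ (fun b' => ?_) b'
        · simp [σ, hb]
          omega
        · simp
      rw [← hσ, minor_comp_perm, hsnoc, minor_Xv_snoc]
      refine Submodule.smul_mem _ _ (neg_mem (minor_mem_span_Sset hj.1 (by omega) fun b' => ?_))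
      have h1 := Finset.mem_Icc.mp (hΘ (σ b'.castSucc))
      have h2 : Θ (σ b'.castSucc) ≠ n + 1 := by
        rw [← hb]
        intro h
        have h' : b'.castSucc = σ b := by
          rw [← hinj h, Equiv.swap_apply_self]
        rw [Equiv.swap_apply_left] at h'
        exact (Fin.castSucc_lt_last b').ne h'
      rw [Finset.mem_Icc]
      omega
    · refine minor_mem_span_Sset hj.1 (by omega) fun b => ?_
      have h1 := Finset.mem_Icc.mp (hΘ b)
      have h2 : Θ b ≠ n + 1 := fun h => hlast ⟨b, h⟩
      rw [Finset.mem_Icc]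
      omega
  · rw [minor_eq_zero_of_not_injective _ _ _ hinj]
    exact zero_mem _

lemma map_minorProducts_eq_span_Sset (n : ℕ) (k : ℕ → ℕ) :
    (minorProducts n k).map (specialize n).toLinearMap = Submodule.span ℂ (Sset n k) := by
  refine le_antisymm ?_ (Submodule.span_le.mpr (Sset_subset_map_minorProducts n k))
  rw [map_minorProducts]
  have h := prod_pow_rel
    (P := fun (A : Submodule ℂ Rpoly) (κ : Multiplicative (ℕ → ℕ)) =>
      A ≤ Submodule.span ℂ (Sset n κ.toAdd))
    (f := specializedSpan n) (g := fun j => Multiplicative.ofAdd (Pi.single (n - j + 1) 1))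
    (S := Finset.Icc 1 n) ?_ ?_ (fun j => k (n - j + 1)) fun j hj => specializedSpan_le hj
  · refine h.trans (Submodule.span_mono (Sset_mono fun j hj => ?_))
    rw [toAdd_prod, Finset.sum_apply, Finset.sum_eq_single j]
    · simp
    · intro j' hj' hne
      rw [Finset.mem_Icc] at hj hj'
      rw [toAdd_pow, toAdd_ofAdd, Pi.smul_apply, Pi.single_eq_of_ne (by omega), smul_zero]
    · exact fun h' => absurd hj h'
  · rw [Submodule.one_le]
    exact Submodule.subset_span (Sset0_subset_Sset _ _ (one_mem_Sset0 _ _))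
  · intro A κ B κ' hA hB
    refine (mul_le_mul' hA hB).trans ?_
    rw [Submodule.span_mul_span]
    refine Submodule.span_mono ?_
    rintro _ ⟨f, hf, g, hg, rfl⟩
    exact mul_mem_Sset hf hg

lemma specialize_topProduct (n : ℕ) (k : ℕ → ℕ) :
    ∃ c : ℂ, specialize n (topProduct n k) = c • 1 := by
  have h : ∀ j ∈ Finset.Icc 1 n, specialize n
      (minor genericArray j (n - j + 1) fun b => j + 1 + b.1) = C ((-1) ^ (n - j + 1)) := by
    intro j hj
    rw [Finset.mem_Icc] at hj
    rw [specialize_minor hj.1 (by omega) fun b => by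
      have := b.2
      rw [Finset.mem_Icc]
      omega, minor, Matrix.det_of_isLowerTriangular]
    · have hd : ∀ a : Fin (n - j + 1), Xv (j + a.1) (j + 1 + a.1) = -1 := fun a => by
        rw [show j + 1 + a.1 = j + a.1 + 1 by omega, Xv_succ]
      simp [hd]
    · intro a b hab
      have hab' : a.1 < b.1 := hab
      exact Xv_eq_zero (by omega)
  refine ⟨∏ j ∈ Finset.Icc 1 n, ((-1) ^ (n - j + 1)) ^ k (n - j + 1), ?_⟩
  rw [topProduct, map_prod, Algebra.smul_def, mul_one, algebraMap_eq, map_prod]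
  refine Finset.prod_congr rfl fun j hj => ?_
  rw [map_pow, h j hj, ← C_pow]

lemma topProduct_mem_minorProducts (n : ℕ) (k : ℕ → ℕ) : topProduct n k ∈ minorProducts n k := by
  refine prod_mem_prod_submodule _ _ _ fun j hj => Submodule.pow_mem_pow _ ?_ _
  rw [Finset.mem_Icc] at hj
  refine Submodule.subset_span ⟨_, fun b => ?_, rfl⟩
  have := b.2
  rw [Finset.mem_Icc]
  omega

/-- The space spanned by the products of minors is generated by `topProduct` under the
polarization operators. -/
lemma minorProducts_le_of_invariant {n : ℕ} {k : ℕ → ℕ} {U : Submodule ℂ Rpoly}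
    (hU : U ≤ minorProducts n k) (htop : topProduct n k ∈ U)
    (hinv : ∀ i ∈ Finset.Icc 1 (n + 1), ∀ j ∈ Finset.Icc 1 (n + 1), ∀ f ∈ U,
      colPolarization n i j f ∈ U) : minorProducts n k ≤ U := by
  have : FiniteDimensional ℂ (minorProducts n k) :=
    Module.Finite.iff_fg.mpr (minorProducts_fg n k)
  have : FiniteDimensional ℂ U := Submodule.finiteDimensional_of_le hU
  let K : Submodule ℂ Rpoly :=
    { carrier := {f | f ∈ minorProducts n k ∧ ∀ v ∈ U, fischer v f = 0}
      add_mem' := fun {f g} hf hg => ⟨add_mem hf.1 hg.1, fun v hv => by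
        rw [fischer_add_right, hf.2 v hv, hg.2 v hv, add_zero]⟩
      zero_mem' := ⟨zero_mem _, fun v _ => fischer_zero_right v⟩
      smul_mem' := fun c f hf => ⟨Submodule.smul_mem _ c hf.1, fun v hv => by
        rw [fischer_smul_right, hf.2 v hv, mul_zero]⟩ }
  intro f hf
  obtain ⟨u, hu, horth⟩ := exists_fischer_orthogonal U f
  have hK : f - u ∈ K := ⟨sub_mem hf (hU hu), horth⟩
  have hzero : f - u = 0 := by
    refine eq_zero_of_mem_invariant (n := n) (K := K) ?_ ?_ ?_ hK
    · intro i hi j hj g hg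
      refine ⟨colPolarization_mem_minorProducts k hi g hg.1, fun v hv => ?_⟩
      rw [← fischer_colPolarization]
      exact hg.2 _ (hinv j hj i hi v hv)
    · exact fun p hp g hg => pderiv_eq_zero_of_mem_minorProducts k hp g hg.1
    · exact fun g hg => eval_superdiag_eq_zero_of_fischer_eq_zero hg.1 (hg.2 _ htop)
  rw [sub_eq_zero.mp hzero]
  exact hu

/-- Theorem 2.4: the smallest subspace of `R` containing `(S_n(λ))₀` and invariant
under all the operators `ρ_{i,j}` (`1 ≤ i, j ≤ n+1`) is the span of `S_n(λ)`. -/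
theorem stmt4 (n : ℕ) (hn : 2 ≤ n) (c : ℂ) (k : ℕ → ℕ) (V : Submodule ℂ Rpoly)
    (hcont : Sset0 n k ⊆ V)
    (hinv : ∀ i ∈ Finset.Icc 1 (n + 1), ∀ j ∈ Finset.Icc 1 (n + 1),
      ∀ v ∈ V, ρ n c k i j v ∈ V)
    (hmin : ∀ W : Submodule ℂ Rpoly, Sset0 n k ⊆ W →
      (∀ i ∈ Finset.Icc 1 (n + 1), ∀ j ∈ Finset.Icc 1 (n + 1), ∀ v ∈ W, ρ n c k i j v ∈ W) →
      V ≤ W) :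
    V = Submodule.span ℂ (Sset n k) := by
  refine le_antisymm (hmin _ ((Sset0_subset_Sset n k).trans Submodule.subset_span) ?_) ?_
  · rw [← map_minorProducts_eq_span_Sset]
    rintro i hi j hj _ ⟨f, hf, rfl⟩
    obtain ⟨μ, hμ⟩ := specialize_colPolarization c k hi hj
    rw [AlgHom.toLinearMap_apply, ← add_sub_cancel_right (ρ n c k i j (specialize n f))
      (μ • specialize n f), ← hμ f hf]
    exact sub_mem (Submodule.mem_map_of_mem (colPolarization_mem_minorProducts k hi f hf))
      (Submodule.smul_mem _ _ (Submodule.mem_map_of_mem hf))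
  · rw [← map_minorProducts_eq_span_Sset, Submodule.map_le_iff_le_comap]
    refine (minorProducts_le_of_invariant inf_le_left
      (U := minorProducts n k ⊓ V.comap (specialize n).toLinearMap) ?_ ?_).trans inf_le_right
    · refine ⟨topProduct_mem_minorProducts n k, ?_⟩
      obtain ⟨a, ha⟩ := specialize_topProduct n k
      change specialize n (topProduct n k) ∈ V
      rw [ha]
      exact Submodule.smul_mem _ _ (hcont (one_mem_Sset0 n k))
    · rintro i hi j hj f ⟨hf, hfV⟩
      refine ⟨colPolarization_mem_minorProducts k hi f hf, ?_⟩
      obtain ⟨μ, hμ⟩ := specialize_colPolarization c k hi hj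
      change specialize n (colPolarization n i j f) ∈ V
      rw [hμ f hf]
      exact add_mem (hinv i hi j hj _ hfV) (Submodule.smul_mem _ _ hfV)

end
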